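/- arXiv:1801.04327 — 9 statements merged into one kernel-verified Lean document; each statement's English description precedes it below -/
import Mathlib

section
/- (Dedekind–Kronecker ramification criterion.) A rational prime p is ramified in K (i.e., there exists a nonzero prime ideal 𝔓 of 𝓞_K with 𝔓² dividing the ideal p𝓞_K) if and only if p divides the discriminant d_K. -/
open NumberField

/-- A prime of `𝓞 K` above `p` is unramified over `ℤ` iff its square does not divide `p`. -/
theorem isUnramifiedAt_int_iff_not_sq_dvd {K : Type*} [Field K] [NumberField K] {p : ℕ}
    (hp : p.Prime) {P : Ideal (𝓞 K)} [P.IsPrime] (hpP : (p : 𝓞 K) ∈ P) :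
    Algebra.IsUnramifiedAt ℤ P ↔ ¬ P ^ 2 ∣ Ideal.span {(p : 𝓞 K)} := by
  have hP0 : P ≠ ⊥ := by
    rintro rfl
    exact hp.ne_zero (by exact_mod_cast Ideal.mem_bot.mp hpP)
  have hPmax : P.IsMaximal := Ring.DimensionLEOne.maximalOfPrime hP0 inferInstance
  have hbot : Ideal.span {(p : ℤ)} ≠ ⊥ := by
    simpa [Ideal.span_singleton_eq_bot] using hp.ne_zero
  have hmax : (Ideal.span {(p : ℤ)}).IsMaximal :=
    Ring.DimensionLEOne.maximalOfPrime hbot <|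
      (Ideal.span_singleton_prime (by exact_mod_cast hp.ne_zero)).mpr
        (Nat.prime_iff_prime_int.mp hp)
  have hmap : (Ideal.span {(p : ℤ)}).map (algebraMap ℤ (𝓞 K)) = Ideal.span {(p : 𝓞 K)} := by
    simp [Ideal.map_span]
  have hfin : Finite (ℤ ⧸ Ideal.span {(p : ℤ)}) := Ideal.finiteQuotientOfFreeOfNeBot _ hbot
  rw [← not_dvd_differentIdeal_iff]
  refine ⟨fun h hsq ↦ h ?_, fun h ↦ ?_⟩
  · simpa using pow_sub_one_dvd_differentIdeal ℤ P 2 hbot (hmap ▸ hsq)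
  · obtain ⟨Q, hQ⟩ := Ideal.dvd_span_singleton.mpr hpP
    have hPQ : IsCoprime P Q := by
      rw [Ideal.isCoprime_iff_sup_eq]
      refine hPmax.1.2 _ (lt_of_le_of_ne le_sup_left fun he ↦ h ?_)
      obtain ⟨R, rfl⟩ := Ideal.dvd_iff_le.mpr (sup_eq_left.mp he.symm)
      exact ⟨R, by rw [hQ, sq, mul_assoc]⟩
    exact not_dvd_differentIdeal_of_isCoprime ℤ P Q hPQ (hQ.symm.trans hmap.symm)

theorem stmt_8 (K : Type*) [Field K] [NumberField K] (p : ℕ) (hp : p.Prime) :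
    (∃ P : Ideal (𝓞 K), P ≠ ⊥ ∧ P.IsPrime ∧
        P ^ 2 ∣ Ideal.span {(p : 𝓞 K)}) ↔
      (p : ℤ) ∣ NumberField.discr K := by
  rw [← not_iff_not, not_dvd_discr_iff_forall_mem K (𝓞 K) (Nat.prime_iff_prime_int.mp hp)]
  push Not
  refine ⟨fun h P hP hpP ↦ ?_, fun h P _ hP hsq ↦ ?_⟩
  · have hpP' : (p : 𝓞 K) ∈ P := by simpa using hpP
    refine (isUnramifiedAt_int_iff_not_sq_dvd hp hpP').mpr (h P ?_ hP)
    rintro rfl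
    exact hp.ne_zero (by exact_mod_cast Ideal.mem_bot.mp hpP')
  · have hpP : (p : 𝓞 K) ∈ P :=
      Ideal.dvd_span_singleton.mp ((dvd_pow_self P two_ne_zero).trans hsq)
    exact (isUnramifiedAt_int_iff_not_sq_dvd hp hpP).mp (h P hP (by simpa using hpP)) hsq
end

section
/- (Kronecker, 1883.) In the polynomial ring R[U_0, …, U_m, V_1, …, V_{n−m+1}], the element F = (∑_{h=0}^{m} M_h U_h)·(∑_{i=1}^{n−m+1} M_{m+i} V_i) satisfies a monic polynomial equation F^ρ + c_{ρ−1} F^{ρ−1} + … + c_1 F + c_0 = 0 of some degree ρ ≥ 1, in which for every r with 0 ≤ r ≤ ρ−1 the coefficient c_r lies in the (ρ−r)-th power of the ideal of R[U_0, …, U_m, V_1, …, V_{n−m+1}] generated by M'_0, M'_1, …, M'_n. -/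
open Polynomial in
theorem Polynomial.contentIdeal_le_iff {R : Type*} [CommSemiring R] {p : R[X]} {I : Ideal R} :
    p.contentIdeal ≤ I ↔ ∀ i, p.coeff i ∈ I := by
  refine ⟨fun h i => h (p.coeff_mem_contentIdeal i), fun h => ?_⟩
  rw [contentIdeal_def, Ideal.span_le]
  intro x hx
  obtain ⟨i, -, rfl⟩ := mem_coeffs_iff.mp hx
  exact h i

open Polynomial in
theorem Polynomial.contentIdeal_eraseLead_le {R : Type*} [CommSemiring R] (p : R[X]) :
    p.eraseLead.contentIdeal ≤ p.contentIdeal := by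
  rw [contentIdeal_le_iff]
  intro i
  rw [eraseLead_coeff]
  split_ifs
  · exact zero_mem _
  · exact p.coeff_mem_contentIdeal i

open Polynomial in
theorem Polynomial.contentIdeal_le_span_leadingCoeff_sup {R : Type*} [CommSemiring R] (p : R[X]) :
    p.contentIdeal ≤ Ideal.span {p.leadingCoeff} ⊔ p.eraseLead.contentIdeal := by
  rw [contentIdeal_le_iff]
  intro i
  by_cases hi : i = p.natDegree
  · subst hi
    exact Ideal.mem_sup_left (Ideal.mem_span_singleton_self _)
  · rw [← eraseLead_coeff_of_ne i hi]
    exact Ideal.mem_sup_right (coeff_mem_contentIdeal _ i)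

open Polynomial in
theorem Polynomial.contentIdeal_mul_eraseLead_le {R : Type*} [CommRing R] (p q : R[X]) :
    (p * q.eraseLead).contentIdeal ≤
      (p * q).contentIdeal ⊔ Ideal.span {q.leadingCoeff} * p.eraseLead.contentIdeal := by
  have key : p * q.eraseLead = p * q - monomial q.natDegree q.leadingCoeff * p.eraseLead -
      monomial (q.natDegree + p.natDegree) (q.leadingCoeff * p.leadingCoeff) := by
    rw [← monomial_mul_monomial]
    linear_combination p * q.eraseLead_add_monomial_natDegree_leadingCoeff +
      monomial q.natDegree q.leadingCoeff * p.eraseLead_add_monomial_natDegree_leadingCoeff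
  rw [contentIdeal_le_iff]
  intro i
  rw [key, coeff_sub, coeff_sub]
  refine sub_mem (sub_mem ?_ ?_) ?_
  · exact Ideal.mem_sup_left (coeff_mem_contentIdeal _ i)
  · refine Ideal.mem_sup_right ?_
    rw [← contentIdeal_monomial q.natDegree]
    exact contentIdeal_mul_le_mul_contentIdeal _ _ (coeff_mem_contentIdeal _ i)
  · refine Ideal.mem_sup_left ?_
    rw [coeff_monomial]
    split_ifs
    · rw [mul_comm, ← coeff_mul_degree_add_degree]
      exact coeff_mem_contentIdeal _ _
    · exact zero_mem _

theorem Ideal.pow_succ_le_mul_sup_pow_succ {R : Type*} [CommSemiring R] {I J K : Ideal R}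
    (h : I ≤ J ⊔ K) (hK : K ≤ I) (k : ℕ) : I ^ (k + 1) ≤ J * I ^ k ⊔ K ^ (k + 1) := by
  induction k with
  | zero => simpa using h
  | succ k ih =>
    calc I ^ (k + 2) = I * I ^ (k + 1) := pow_succ' _ _
      _ ≤ (J ⊔ K) * I ^ (k + 1) := Ideal.mul_mono_left h
      _ = J * I ^ (k + 1) ⊔ K * I ^ (k + 1) := Ideal.sup_mul _ _ _
      _ ≤ J * I ^ (k + 1) ⊔ (J * I ^ (k + 1) ⊔ K ^ (k + 2)) := by
        refine sup_le_sup_left ((Ideal.mul_mono_right ih).trans ?_) _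
        rw [Ideal.mul_sup, ← pow_succ']
        refine sup_le_sup_right ?_ _
        rw [mul_left_comm, pow_succ' I]
        exact Ideal.mul_mono_right (Ideal.mul_mono_left hK)
      _ = J * I ^ (k + 1) ⊔ K ^ (k + 2) := by rw [← sup_assoc, sup_idem]

open Polynomial in
/-- The **Dedekind–Mertens lemma**, in terms of the number of nonzero coefficients of `q`. -/
theorem Polynomial.contentIdeal_pow_succ_mul_contentIdeal_le {R : Type*} [CommRing R]
    (p q : R[X]) (k : ℕ) (hk : q.support.card ≤ k + 1) :
    p.contentIdeal ^ (k + 1) * q.contentIdeal ≤ p.contentIdeal ^ k * (p * q).contentIdeal := by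
  induction hN : p.support.card + q.support.card using Nat.strong_induction_on
    generalizing p q k with
  | _ N ih =>
  subst hN
  rcases eq_or_ne p 0 with rfl | hp
  · simp
  rcases eq_or_ne q 0 with rfl | hq
  · simp
  have hpc := eraseLead_support_card_lt hp
  have hqc := eraseLead_support_card_lt hq
  have hlead : Ideal.span {p.leadingCoeff} * Ideal.span {q.leadingCoeff} ≤
      (p * q).contentIdeal := by
    rw [Ideal.span_singleton_mul_span_singleton, Ideal.span_singleton_le_iff_mem,
      ← coeff_mul_degree_add_degree]
    exact coeff_mem_contentIdeal _ _
  have hpl : Ideal.span {p.leadingCoeff} ≤ p.contentIdeal := by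
    rw [Ideal.span_singleton_le_iff_mem]
    exact coeff_mem_contentIdeal _ _
  have hpe := p.contentIdeal_eraseLead_le
  have herase : Ideal.span {p.leadingCoeff} * p.contentIdeal ^ k * q.eraseLead.contentIdeal ≤
      p.contentIdeal ^ k * (p * q).contentIdeal := by
    cases k with
    | zero =>
      have : q.eraseLead = 0 := by
        rw [← card_support_eq_zero]
        omega
      simp [this]
    | succ j =>
      have h := ih _ (by omega) p q.eraseLead j (by omega) rfl
      rw [mul_assoc]
      refine (Ideal.mul_mono_right
        (h.trans (Ideal.mul_mono_right (contentIdeal_mul_eraseLead_le p q)))).trans ?_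
      rw [Ideal.mul_sup, Ideal.mul_sup, pow_succ']
      refine sup_le ?_ ?_
      · rw [← mul_assoc]
        exact Ideal.mul_mono_left (Ideal.mul_mono_left hpl)
      · calc _ = p.eraseLead.contentIdeal * p.contentIdeal ^ j *
              (Ideal.span {p.leadingCoeff} * Ideal.span {q.leadingCoeff}) := by ring
          _ ≤ _ := Ideal.mul_mono (Ideal.mul_mono_left hpe) hlead
  calc p.contentIdeal ^ (k + 1) * q.contentIdeal
      ≤ (Ideal.span {p.leadingCoeff} * p.contentIdeal ^ k ⊔
          p.eraseLead.contentIdeal ^ (k + 1)) * q.contentIdeal :=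
        Ideal.mul_mono_left (Ideal.pow_succ_le_mul_sup_pow_succ
          p.contentIdeal_le_span_leadingCoeff_sup hpe k)
    _ = Ideal.span {p.leadingCoeff} * p.contentIdeal ^ k * q.contentIdeal ⊔
          p.eraseLead.contentIdeal ^ (k + 1) * q.contentIdeal := Ideal.sup_mul _ _ _
    _ ≤ _ := by
      refine sup_le ?_ ?_
      · refine (Ideal.mul_mono_right q.contentIdeal_le_span_leadingCoeff_sup).trans ?_
        rw [Ideal.mul_sup]
        refine sup_le ?_ herase
        rw [mul_right_comm, mul_comm]
        exact Ideal.mul_mono_right hlead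
      · have hle := contentIdeal_mul_eraseLead_le q p
        rw [mul_comm q, mul_comm q] at hle
        refine (ih _ (by omega) p.eraseLead q k hk rfl).trans
          ((Ideal.mul_mono_right hle).trans ?_)
        rw [Ideal.mul_sup]
        refine sup_le (Ideal.mul_mono_left (Ideal.pow_right_mono hpe k)) (le_trans ?_ herase)
        rw [← mul_assoc, mul_comm (_ ^ k)]
        exact Ideal.mul_mono_left (Ideal.mul_mono_right (Ideal.pow_right_mono hpe k))

open Polynomial in
/-- The **determinant trick**: if `x` multiplies a nonzero finitely generated ideal `N` of a domain
into `I * N`, then `x` is integral over the ideal `I`. -/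
theorem Ideal.exists_monic_coeff_mem_pow_eval_eq_zero {S : Type*} [CommRing S] [IsDomain S]
    {I N : Ideal S} (hN : N.FG) (hN0 : N ≠ ⊥) {x : S} (hx : ∀ y ∈ N, x * y ∈ I * N) :
    ∃ p : S[X], p.Monic ∧ 1 ≤ p.natDegree ∧ (∀ k, p.coeff k ∈ I ^ (p.natDegree - k)) ∧
      p.eval x = 0 := by
  have : Module.Finite S N := Module.Finite.iff_fg.mpr hN
  obtain ⟨p, hmonic, -, hcoeff, hp⟩ :=
    LinearMap.exists_monic_and_natDegree_eq_and_coeff_mem_pow_and_aeval_eq_zero S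
      (algebraMap S (Module.End S N) x) I (by
        rintro _ ⟨y, rfl⟩
        have hmap : (I • (⊤ : Submodule S N)).map N.subtype = I * N := by
          rw [Submodule.map_smul'', Submodule.map_top, Submodule.range_subtype, smul_eq_mul]
        have hy := hx y y.2
        rw [← hmap] at hy
        obtain ⟨z, hz, hzy⟩ := hy
        have hzx : algebraMap S (Module.End S N) x y = z := Subtype.ext hzy.symm
        rwa [hzx])
  have heval : p.eval x = 0 := by
    obtain ⟨y, hy, hy0⟩ := Submodule.exists_mem_ne_zero_of_ne_bot hN0
    have h : p.eval x • (⟨y, hy⟩ : N) = 0 := by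
      rw [aeval_algebraMap_apply, coe_aeval_eq_eval] at hp
      exact LinearMap.congr_fun hp ⟨y, hy⟩
    exact (mul_eq_zero.mp (congrArg Subtype.val h)).resolve_right hy0
  refine ⟨p, hmonic, Nat.one_le_iff_ne_zero.mpr fun h0 => ?_, hcoeff, heval⟩
  rw [hmonic.natDegree_eq_zero.mp h0, eval_one] at heval
  exact one_ne_zero heval

open Polynomial in
theorem Polynomial.exists_monic_coeff_mem_contentIdeal_pow_eval_eq_zero {S : Type*} [CommRing S]
    [IsDomain S] (p q : S[X]) {x : S} (hx : x ∈ p.contentIdeal * q.contentIdeal) :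
    ∃ r : S[X], r.Monic ∧ 1 ≤ r.natDegree ∧
      (∀ k, r.coeff k ∈ (p * q).contentIdeal ^ (r.natDegree - k)) ∧ r.eval x = 0 := by
  rcases eq_or_ne p 0 with rfl | hp
  · have hx0 : x = 0 := by simpa using hx
    refine ⟨X, monic_X, natDegree_X.ge, fun k => ?_, by simp [hx0]⟩
    rcases eq_or_ne k 1 with rfl | hk
    · simp
    · simp [coeff_X_of_ne_one hk]
  · refine Ideal.exists_monic_coeff_mem_pow_eval_eq_zero
      (N := p.contentIdeal ^ q.support.card) (p.contentIdeal_FG.pow)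
      (pow_ne_zero _ (by simpa using hp)) fun y hy => ?_
    have h := contentIdeal_pow_succ_mul_contentIdeal_le p q q.support.card (Nat.le_succ _)
    rw [mul_comm (p * q).contentIdeal]
    refine h ?_
    rw [pow_succ, mul_assoc, mul_comm x]
    exact Ideal.mul_mem_mul hy hx

open Polynomial in
theorem Polynomial.coeff_sum_range_C_mul_X_pow {R : Type*} [Semiring R] (a : ℕ → R) (N i : ℕ) :
    (∑ j ∈ Finset.range N, C (a j) * X ^ j).coeff i = if i < N then a i else 0 := by
  simp [coeff_C_mul, coeff_X_pow]

theorem stmt_11 (R : Type*) [CommRing R] [IsDomain R] (n m : ℕ) (hmn : m ≤ n)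
    (M M' : ℕ → R)
    (hM' : (∑ h ∈ Finset.range (m + 1), Polynomial.C (M h) * Polynomial.X ^ h) *
        (∑ i ∈ Finset.range (n - m + 1), Polynomial.C (M (m + 1 + i)) * Polynomial.X ^ i) =
      ∑ k ∈ Finset.range (n + 1), Polynomial.C (M' k) * Polynomial.X ^ k) :
    ∃ ρ : ℕ, 1 ≤ ρ ∧ ∃ c : ℕ → MvPolynomial (Fin (m + 1) ⊕ Fin (n - m + 1)) R,
      ((∑ h : Fin (m + 1), MvPolynomial.C (M h) * MvPolynomial.X (Sum.inl h)) *
            (∑ i : Fin (n - m + 1),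
              MvPolynomial.C (M (m + 1 + i)) * MvPolynomial.X (Sum.inr i))) ^ ρ +
          (∑ r ∈ Finset.range ρ, c r *
            ((∑ h : Fin (m + 1), MvPolynomial.C (M h) * MvPolynomial.X (Sum.inl h)) *
              (∑ i : Fin (n - m + 1),
                MvPolynomial.C (M (m + 1 + i)) * MvPolynomial.X (Sum.inr i))) ^ r) = 0 ∧
      ∀ r < ρ, c r ∈ (Ideal.span (Set.range fun k : Fin (n + 1) =>
        (MvPolynomial.C (M' k) : MvPolynomial (Fin (m + 1) ⊕ Fin (n - m + 1)) R))) ^ (ρ - r) := by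
  set S := MvPolynomial (Fin (m + 1) ⊕ Fin (n - m + 1)) R
  set f : Polynomial R := ∑ h ∈ Finset.range (m + 1), Polynomial.C (M h) * Polynomial.X ^ h with hf
  set g : Polynomial R :=
    ∑ i ∈ Finset.range (n - m + 1), Polynomial.C (M (m + 1 + i)) * Polynomial.X ^ i with hg
  have hF : (∑ h : Fin (m + 1), MvPolynomial.C (M h) * MvPolynomial.X (Sum.inl h) : S) *
      (∑ i : Fin (n - m + 1), MvPolynomial.C (M (m + 1 + i)) * MvPolynomial.X (Sum.inr i)) ∈
        (f.map MvPolynomial.C).contentIdeal * (g.map MvPolynomial.C).contentIdeal := by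
    refine Ideal.mul_mem_mul (sum_mem fun h _ => Ideal.mul_mem_right _ _ ?_)
      (sum_mem fun i _ => Ideal.mul_mem_right _ _ ?_)
    · have := (f.map (MvPolynomial.C : R →+* S)).coeff_mem_contentIdeal h
      rwa [Polynomial.coeff_map, hf, Polynomial.coeff_sum_range_C_mul_X_pow, if_pos h.2] at this
    · have := (g.map (MvPolynomial.C : R →+* S)).coeff_mem_contentIdeal i
      rwa [Polynomial.coeff_map, hg,
        Polynomial.coeff_sum_range_C_mul_X_pow (fun i => M (m + 1 + i)), if_pos i.2] at this
  have hI : (f.map MvPolynomial.C * g.map MvPolynomial.C).contentIdeal ≤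
      Ideal.span (Set.range fun k : Fin (n + 1) => (MvPolynomial.C (M' k) : S)) := by
    rw [← Polynomial.map_mul, hM', Polynomial.contentIdeal_le_iff]
    intro i
    rw [Polynomial.coeff_map, Polynomial.coeff_sum_range_C_mul_X_pow]
    split_ifs with hi
    · exact Ideal.subset_span ⟨⟨i, hi⟩, rfl⟩
    · simp
  obtain ⟨p, hmonic, hdeg, hcoeff, heval⟩ :=
    Polynomial.exists_monic_coeff_mem_contentIdeal_pow_eval_eq_zero _ _ hF
  refine ⟨p.natDegree, hdeg, p.coeff, ?_, fun r _ => Ideal.pow_right_mono hI _ (hcoeff r)⟩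
  rw [Polynomial.eval_eq_sum_range, Finset.sum_range_succ, hmonic.coeff_natDegree, one_mul] at heval
  exact (add_comm _ _).trans heval
end

section
/- (Prague theorem corollary.) For every h with 0 ≤ h ≤ m and every i with 1 ≤ i ≤ n−m+1, the product M_h · M_{m+i} is integral over the subring ℤ[M'_0, M'_1, …, M'_n] of R generated by M'_0, …, M'_n. -/
open Polynomial in
theorem Polynomial.exists_forall_valuation_coeff_le {R Γ₀ : Type*} [CommRing R]
    [LinearOrderedCommGroupWithZero Γ₀] (v : Valuation R Γ₀) (p : R[X]) :
    ∃ i, (∀ k, v (p.coeff k) ≤ v (p.coeff i)) ∧ ∀ k < i, v (p.coeff k) < v (p.coeff i) := by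
  classical
  have hex : ∃ i, ∀ k, v (p.coeff k) ≤ v (p.coeff i) := by
    obtain ⟨i, -, hi⟩ := (Finset.range (p.natDegree + 1)).exists_max_image
      (fun k ↦ v (p.coeff k)) ⟨0, by simp⟩
    refine ⟨i, fun k ↦ ?_⟩
    by_cases hk : k ≤ p.natDegree
    · exact hi k (by simpa [Nat.lt_succ_iff] using hk)
    · simp [coeff_eq_zero_of_natDegree_lt (not_le.mp hk)]
  refine ⟨Nat.find hex, Nat.find_spec hex, fun k hk ↦ ?_⟩
  obtain ⟨l, hl⟩ := not_forall.mp (Nat.find_min hex hk)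
  exact (not_le.mp hl).trans_le (Nat.find_spec hex l)

open Polynomial in
theorem Polynomial.exists_valuation_coeff_mul_coeff_le {R Γ₀ : Type*} [CommRing R]
    [LinearOrderedCommGroupWithZero Γ₀] (v : Valuation R Γ₀) (p q : R[X]) :
    ∃ k, ∀ i j, v (p.coeff i * q.coeff j) ≤ v ((p * q).coeff k) := by
  obtain ⟨i₀, hi, hi'⟩ := p.exists_forall_valuation_coeff_le v
  obtain ⟨j₀, hj, hj'⟩ := q.exists_forall_valuation_coeff_le v
  refine ⟨i₀ + j₀, fun i j ↦ ?_⟩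
  have hle : v (p.coeff i * q.coeff j) ≤ v (p.coeff i₀ * q.coeff j₀) := by
    simpa only [map_mul] using mul_le_mul' (hi i) (hj j)
  refine hle.trans ?_
  by_cases h0 : v (p.coeff i₀ * q.coeff j₀) = 0
  · simp [h0]
  have hp : 0 < v (p.coeff i₀) := zero_lt_iff.mpr fun h ↦ h0 (by simp [h])
  have hq : 0 < v (q.coeff j₀) := zero_lt_iff.mpr fun h ↦ h0 (by simp [h])
  rw [coeff_mul, ← Finset.add_sum_erase _ _
    (Finset.HasAntidiagonal.mem_antidiagonal.mpr rfl :
      (i₀, j₀) ∈ Finset.HasAntidiagonal.antidiagonal (i₀ + j₀))]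
  refine (v.map_add_eq_of_lt_left (v.map_sum_lt h0 ?_)).ge
  rintro ⟨a, b⟩ hab
  obtain ⟨hne, hab⟩ : (a, b) ≠ (i₀, j₀) ∧ a + b = i₀ + j₀ := by simpa using hab
  have hcases : a < i₀ ∨ b < j₀ := by
    by_contra! h
    exact hne (by ext <;> simp <;> omega)
  simp only [map_mul]
  rcases hcases with ha | hb
  · exact (mul_le_mul_right (hj b) _).trans_lt (mul_lt_mul_of_pos_right (hi' a ha) hq)
  · exact (mul_le_mul_left (hi a) _).trans_lt (mul_lt_mul_of_pos_left (hj' b hb) hp)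

open Polynomial in
theorem Polynomial.isIntegral_coeff_mul_coeff_of_field {A K : Type*} [CommRing A] [Field K]
    [Algebra A K] {p q : K[X]} (h : ∀ k, IsIntegral A ((p * q).coeff k)) (i j : ℕ) :
    IsIntegral A (p.coeff i * q.coeff j) := by
  by_contra hx
  have : IsIntegrallyClosedIn (integralClosure A K).toSubring K :=
    inferInstanceAs (IsIntegrallyClosedIn (integralClosure A K) K)
  obtain ⟨V, hV, hxV⟩ := Subring.exists_le_valuationSubring_of_isIntegrallyClosedIn
    (R := (integralClosure A K).toSubring) hx
  obtain ⟨k, hk⟩ := exists_valuation_coeff_mul_coeff_le V.valuation p q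
  exact hxV ((V.valuation_le_one_iff _).mp
    ((hk i j).trans ((V.valuation_le_one_iff _).mpr (hV (h k)))))

open Polynomial in
/-- If all coefficients of a product of polynomials over a domain are integral over `A`, then so
are all products of a coefficient of one factor and a coefficient of the other. -/
theorem Polynomial.isIntegral_coeff_mul_coeff {A R : Type*} [CommRing A] [CommRing R] [IsDomain R]
    [Algebra A R] {p q : R[X]} (h : ∀ k, IsIntegral A ((p * q).coeff k)) (i j : ℕ) :
    IsIntegral A (p.coeff i * q.coeff j) := by
  rw [← isIntegral_algebraMap_iff (IsFractionRing.injective R (FractionRing R)), map_mul,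
    ← coeff_map, ← coeff_map]
  refine isIntegral_coeff_mul_coeff_of_field (fun k ↦ ?_) i j
  rw [← Polynomial.map_mul, coeff_map]
  exact (h k).algebraMap

theorem stmt_12 (R : Type*) [CommRing R] [IsDomain R] (n m : ℕ) (hmn : m ≤ n)
    (M M' : ℕ → R)
    (hM' : (∑ h ∈ Finset.range (m + 1), Polynomial.C (M h) * Polynomial.X ^ h) *
        (∑ i ∈ Finset.range (n - m + 1), Polynomial.C (M (m + 1 + i)) * Polynomial.X ^ i) =
      ∑ k ∈ Finset.range (n + 1), Polynomial.C (M' k) * Polynomial.X ^ k) :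
    ∀ h ≤ m, ∀ i, 1 ≤ i → i ≤ n - m + 1 →
      IsIntegral (Algebra.adjoin ℤ (Set.range fun k : Fin (n + 1) => M' k))
        (M h * M (m + i)) := by
  intro h hh i hi hi'
  obtain ⟨i, rfl⟩ := Nat.exists_eq_add_of_le hi
  have key := Polynomial.isIntegral_coeff_mul_coeff
    (A := Algebra.adjoin ℤ (Set.range fun k : Fin (n + 1) => M' k))
    (p := ∑ h ∈ Finset.range (m + 1), Polynomial.C (M h) * Polynomial.X ^ h)
    (q := ∑ i ∈ Finset.range (n - m + 1), Polynomial.C (M (m + 1 + i)) * Polynomial.X ^ i)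
    (fun k ↦ ?_) h i
  · have h₁ : h < m + 1 := by omega
    have h₂ : i < n - m + 1 := by omega
    simpa [Polynomial.finsetSum_coeff, Polynomial.coeff_C_mul_X_pow, h₁, h₂, add_assoc] using key
  · rw [hM']
    simp only [Polynomial.finsetSum_coeff, Polynomial.coeff_C_mul_X_pow, Finset.sum_ite_eq,
      Finset.mem_range]
    split_ifs with hk
    · exact isIntegral_algebraMap (R := Algebra.adjoin ℤ (Set.range fun k : Fin (n + 1) => M' k))
        (x := ⟨M' k, Algebra.subset_adjoin ⟨⟨k, hk⟩, rfl⟩⟩)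
    · exact isIntegral_zero
end

section
/- (Euler–Jacobi vanishing theorem.) Let F_1, …, F_n ∈ k[x_1, …, x_n] with total degrees d_1, …, d_n ≥ 1, and let f_i be the degree-d_i homogeneous component (leading form) of F_i. Assume: (i) the only common zero of f_1, …, f_n in kⁿ is the origin; (ii) the set Z of common zeros of F_1, …, F_n in kⁿ is finite; (iii) the Jacobian determinant J = det(∂F_i/∂x_h)_{1≤i,h≤n} is nonzero at every point of Z. Then for every polynomial G ∈ k[x_1, …, x_n] with total degree strictly less than (∑_{i=1}^n d_i) − n, one has ∑_{ξ ∈ Z} G(ξ)/J(ξ) = 0. -/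
open MvPolynomial

lemma MvPolynomial.coeff_eq_zero_of_totalDegree_lt_degree {σ R : Type*} [CommSemiring R]
    {f : MvPolynomial σ R} {d : σ →₀ ℕ} (h : f.totalDegree < d.degree) : coeff d f = 0 :=
  coeff_eq_zero_of_totalDegree_lt h

lemma MvPolynomial.homogeneousComponent_mul_of_totalDegree_le {σ R : Type*} [CommSemiring R]
    {p q : MvPolynomial σ R} {a b : ℕ} (hp : p.totalDegree ≤ a) (hq : q.totalDegree ≤ b) :
    homogeneousComponent (a + b) (p * q) =
      homogeneousComponent a p * homogeneousComponent b q := by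
  classical
  ext d
  rw [coeff_homogeneousComponent]
  split_ifs with hd
  · rw [coeff_mul, coeff_mul]
    refine Finset.sum_congr rfl fun x hx => ?_
    rw [Finset.HasAntidiagonal.mem_antidiagonal] at hx
    rw [coeff_homogeneousComponent, coeff_homogeneousComponent]
    have hsum : x.1.degree + x.2.degree = a + b := by rw [← hd, ← hx, map_add]
    by_cases h1 : a < x.1.degree
    · rw [coeff_eq_zero_of_totalDegree_lt_degree (hp.trans_lt h1)]; simp
    by_cases h2 : b < x.2.degree
    · rw [coeff_eq_zero_of_totalDegree_lt_degree (hq.trans_lt h2)]; simp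
    rw [if_pos (by omega), if_pos (by omega)]
  · exact (((homogeneousComponent_isHomogeneous a p).mul
      (homogeneousComponent_isHomogeneous b q)).coeff_eq_zero hd).symm

lemma MvPolynomial.homogeneousComponent_mul_of_isHomogeneous {σ R : Type*} [CommSemiring R]
    {p q : MvPolynomial σ R} {a b : ℕ} (hq : q.IsHomogeneous b) :
    homogeneousComponent (a + b) (p * q) = homogeneousComponent a p * q := by
  classical
  ext d
  rw [coeff_homogeneousComponent]
  split_ifs with hd
  · rw [coeff_mul, coeff_mul]
    refine Finset.sum_congr rfl fun x hx => ?_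
    rw [Finset.HasAntidiagonal.mem_antidiagonal] at hx
    rw [coeff_homogeneousComponent]
    have hsum : x.1.degree + x.2.degree = a + b := by rw [← hd, ← hx, map_add]
    by_cases h1 : x.1.degree = a
    · rw [if_pos h1]
    · rw [hq.coeff_eq_zero (by omega)]; simp
  · exact (((homogeneousComponent_isHomogeneous a p).mul hq).coeff_eq_zero hd).symm

lemma MvPolynomial.homogeneousComponent_prod_of_totalDegree_le {σ R ι : Type*} [CommSemiring R]
    (s : Finset ι) {p : ι → MvPolynomial σ R} {e : ι → ℕ}
    (hp : ∀ i ∈ s, (p i).totalDegree ≤ e i) :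
    homogeneousComponent (∑ i ∈ s, e i) (∏ i ∈ s, p i) =
      ∏ i ∈ s, homogeneousComponent (e i) (p i) := by
  induction s using Finset.cons_induction with
  | empty => simp [homogeneousComponent_zero]
  | cons i s hi ih =>
    have hs : ∀ j ∈ s, (p j).totalDegree ≤ e j := fun j hj => hp j (Finset.mem_cons_of_mem hj)
    rw [Finset.sum_cons, Finset.prod_cons, Finset.prod_cons,
      homogeneousComponent_mul_of_totalDegree_le (hp i (Finset.mem_cons_self i s))
        ((totalDegree_finsetProd s p).trans (Finset.sum_le_sum hs)), ih hs]

lemma MvPolynomial.homogeneousComponent_det_of_totalDegree_le {σ R ι : Type*} [CommRing R]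
    [Fintype ι] [DecidableEq ι] {M : Matrix ι ι (MvPolynomial σ R)} {e : ℕ}
    (hM : ∀ i j, (M i j).totalDegree ≤ e) :
    homogeneousComponent (Fintype.card ι * e) M.det =
      (M.map (homogeneousComponent e)).det := by
  rw [Matrix.det_apply, Matrix.det_apply, map_sum]
  refine Finset.sum_congr rfl fun τ _ => ?_
  have h : homogeneousComponent (Fintype.card ι * e) (∏ i, M (τ i) i) =
      ∏ i, homogeneousComponent e (M (τ i) i) := by
    rw [← homogeneousComponent_prod_of_totalDegree_le Finset.univ
      (p := fun i => M (τ i) i) (e := fun _ => e) fun i _ => hM _ _]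
    simp
  rcases Int.units_eq_one_or (Equiv.Perm.sign τ) with hs | hs <;> simp [hs, h]

lemma MvPolynomial.totalDegree_det_le {σ R ι : Type*} [CommRing R]
    [Fintype ι] [DecidableEq ι] {M : Matrix ι ι (MvPolynomial σ R)} {e : ι → ℕ}
    (hM : ∀ i j, (M i j).totalDegree ≤ e j) : M.det.totalDegree ≤ ∑ j, e j := by
  rw [Matrix.det_apply]
  refine totalDegree_finsetSum_le fun τ _ => ?_
  have h : (∏ i, M (τ i) i).totalDegree ≤ ∑ j, e j :=
    (totalDegree_finsetProd _ _).trans (Finset.sum_le_sum fun i _ => hM _ _)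
  rcases Int.units_eq_one_or (Equiv.Perm.sign τ) with hs | hs <;> simpa [hs] using h

/-- A Taylor-type division: subtracting its value at `ξ`, a polynomial is a combination of the
`X h - ξ h`, with coefficients of smaller degree. -/
lemma MvPolynomial.exists_sub_C_eval_eq_sum {σ R : Type*} [CommRing R] [Fintype σ]
    (ξ : σ → R) {e : ℕ} (P : MvPolynomial σ R) (hP : P.totalDegree ≤ e + 1) :
    ∃ θ : σ → MvPolynomial σ R, P - C (eval ξ P) = ∑ h, θ h * (X h - C (ξ h)) ∧
      ∀ h, (θ h).totalDegree ≤ e := by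
  classical
  have hmon : ∀ (N : ℕ) (α : σ →₀ ℕ), α.degree = N → ∃ θ : σ → MvPolynomial σ R,
      monomial α (1 : R) - C (eval ξ (monomial α 1)) = ∑ h, θ h * (X h - C (ξ h)) ∧
      ∀ h, (θ h).totalDegree ≤ N - 1 := by
    intro N
    induction N with
    | zero =>
      intro α hα
      rw [Finsupp.degree_eq_zero_iff] at hα
      exact ⟨0, by simp [hα], by simp⟩
    | succ N ih =>
      intro α hα
      obtain ⟨h, hh⟩ : ∃ h, α h ≠ 0 := by
        by_contra! H
        rw [show α = 0 from Finsupp.ext H] at hα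
        simp at hα
      obtain ⟨β, rfl⟩ : ∃ β, α = β + Finsupp.single h 1 :=
        ⟨α - Finsupp.single h 1, (tsub_add_cancel_of_le (by simpa [Nat.one_le_iff_ne_zero])).symm⟩
      have hβ : β.degree = N := by simpa using hα
      obtain ⟨θ, hθ, hdeg⟩ := ih β hβ
      have hm : monomial (β + Finsupp.single h 1) (1 : R) = monomial β 1 * X h := by
        rw [X, monomial_mul, one_mul]
      refine ⟨fun l => C (ξ h) * θ l + if l = h then monomial β 1 else 0, ?_, fun l => ?_⟩
      · simp only [add_mul, Finset.sum_add_distrib, mul_assoc, ← Finset.mul_sum, ← hθ, ite_mul,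
          zero_mul, Finset.sum_ite_eq', Finset.mem_univ, if_true, hm, map_mul, eval_X]
        ring
      · have hmd : (monomial β (1 : R)).totalDegree ≤ N :=
          (totalDegree_monomial_le _ _).trans_eq hβ
        refine (totalDegree_add _ _).trans (max_le ?_ ?_)
        · refine (totalDegree_mul _ _).trans ?_
          have := hdeg l
          rw [totalDegree_C]; omega
        · split_ifs
          · simpa using hmd
          · simp
  choose! θ hθ using fun α => hmon _ α rfl
  refine ⟨fun h => ∑ α ∈ P.support, C (coeff α P) * θ α h, ?_, fun h => ?_⟩
  · conv_lhs => rw [P.as_sum]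
    simp only [map_sum, ← Finset.sum_sub_distrib, Finset.sum_mul]
    rw [Finset.sum_comm]
    refine Finset.sum_congr rfl fun α _ => ?_
    simp only [mul_assoc, ← Finset.mul_sum, ← (hθ α).1]
    rw [← mul_one (coeff α P), ← C_mul_monomial]
    simp [mul_sub]
  · refine totalDegree_finsetSum_le fun α hα => (totalDegree_mul _ _).trans ?_
    have h1 := (hθ α).2 h
    have h2 : α.degree ≤ P.totalDegree := le_totalDegree hα
    rw [totalDegree_C]; omega

/-- The residue at infinity of a system `X j ^ (q + 1) + L j` with `L j` of degree at most `q`. -/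
lemma exists_residue_functional {k : Type*} [Field k] {n q : ℕ}
    (L : Fin n → MvPolynomial (Fin n) k) (hL : ∀ j, (L j).totalDegree ≤ q) :
    ∃ ρ : MvPolynomial (Fin n) k →ₗ[k] k, (∀ j g, ρ (g * (X j ^ (q + 1) + L j)) = 0) ∧
      ∀ g, g.totalDegree ≤ n * q →
        ρ g = coeff (Finsupp.equivFunOnFinite.symm fun _ => q) g := by
  classical
  let r : (Fin n → ℕ) → (Fin n →₀ ℕ) := fun s =>
    Finsupp.equivFunOnFinite.symm fun i => (q + 1) * s i + q
  let T : MvPolynomial (Fin n) k → (Fin n → ℕ) → k := fun g s =>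
    (-1) ^ (∑ i, s i) * coeff (r s) (g * ∏ i, L i ^ s i)
  have hr : ∀ s, (r s).degree = q * ∑ i, s i + ∑ i, s i + n * q := fun s => by
    simp [r, Finsupp.degree_eq_sum, Finset.sum_add_distrib, ← Finset.mul_sum]; ring
  have hT0 : ∀ g s, g.totalDegree < ∑ i, s i + n * q → T g s = 0 := by
    intro g s h
    have h1 : (∏ i, L i ^ s i).totalDegree ≤ q * ∑ i, s i := by
      refine (totalDegree_finsetProd _ _).trans ?_
      rw [Finset.mul_sum]
      refine Finset.sum_le_sum fun i _ => (totalDegree_pow _ _).trans ?_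
      rw [mul_comm]
      exact Nat.mul_le_mul_right _ (hL i)
    have h2 := totalDegree_mul g (∏ i, L i ^ s i)
    simp only [T]
    rw [coeff_eq_zero_of_totalDegree_lt_degree (by rw [hr]; omega), mul_zero]
  have hfin : ∀ g, (T g).HasFiniteSupport := by
    intro g
    refine (Set.finite_Iic (fun _ : Fin n => g.totalDegree)).subset fun s hs i => ?_
    have h1 : ¬ g.totalDegree < ∑ i, s i + n * q := fun h => hs (hT0 g s h)
    have h2 : s i ≤ ∑ i, s i := Finset.single_le_sum (fun _ _ => Nat.zero_le _) (Finset.mem_univ i)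
    show s i ≤ g.totalDegree
    omega
  have hadd : ∀ f g, T (f + g) = fun s => T f s + T g s := fun f g => by
    funext s; simp [T, add_mul, mul_add]
  have hsmul : ∀ (c : k) g, T (c • g) = fun s => c • T g s := fun c g => by
    funext s; simp [T]; ring
  let ρ : MvPolynomial (Fin n) k →ₗ[k] k :=
    { toFun := fun g => ∑ᶠ s, T g s
      map_add' := fun f g => by rw [hadd, finsum_add_distrib (hfin f) (hfin g)]
      map_smul' := fun c g => by rw [hsmul, ← smul_finsum]; rfl }
  refine ⟨ρ, fun j g => ?_, fun g hg => ?_⟩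
  · rw [mul_add, map_add]
    have hinj : Function.Injective fun s : Fin n → ℕ => s + Pi.single j 1 :=
      fun a b hab => add_right_cancel hab
    have hsupp : Function.support (T (g * X j ^ (q + 1))) ⊆
        Set.range fun s : Fin n → ℕ => s + Pi.single j 1 := by
      intro s hs
      by_contra hrange
      have hsj : s j = 0 := by
        by_contra hne
        refine hrange ⟨s - Pi.single j 1, tsub_add_cancel_of_le fun i => ?_⟩
        by_cases hi : i = j
        · subst hi; simpa [Nat.one_le_iff_ne_zero]
        · simp [hi]
      refine hs ?_
      simp only [T]
      rw [mul_right_comm, X_pow_eq_monomial, coeff_mul_monomial', if_neg, mul_zero]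
      intro hle
      simpa [r, hsj] using hle j
    have hshift : ∀ s, T (g * X j ^ (q + 1)) (s + Pi.single j 1) = - T (g * L j) s := by
      intro s
      have hr' : r (s + Pi.single j 1) = r s + Finsupp.single j (q + 1) := by
        ext i
        by_cases hi : i = j
        · subst hi; simp [r]; ring
        · simp [r, hi]
      have hprod : ∏ i, L i ^ (s + Pi.single j 1 : Fin n → ℕ) i = L j * ∏ i, L i ^ s i := by
        simp only [Pi.add_apply, pow_add, Finset.prod_mul_distrib]
        rw [mul_comm, Finset.prod_eq_single j (fun b _ hb => by simp [hb]) (by simp)]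
        simp
      have hsum : ∑ i, (s + Pi.single j 1 : Fin n → ℕ) i = ∑ i, s i + 1 := by
        simp [Finset.sum_add_distrib]
      simp only [T]
      rw [hr', hprod, hsum, mul_right_comm, X_pow_eq_monomial, coeff_mul_monomial, mul_one,
        pow_succ, mul_assoc g]
      ring
    have h1 : ρ (g * X j ^ (q + 1)) =
        ∑ᶠ s : Fin n → ℕ, T (g * X j ^ (q + 1)) (s + Pi.single j 1) := by
      rw [← finsum_mem_range hinj, finsum_mem_def, Set.indicator_eq_self.2 hsupp]
      rfl
    rw [h1]
    simp only [hshift]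
    rw [finsum_neg_distrib]
    exact neg_add_cancel _
  · show ∑ᶠ s, T g s = _
    rw [finsum_eq_single _ 0 fun s hs => hT0 g s ?_]
    · simp [T, r]
    · have : 0 < ∑ i, s i := by
        rw [pos_iff_ne_zero]
        intro h
        exact hs (funext fun i => Finset.sum_eq_zero_iff.1 h i (Finset.mem_univ i))
      omega

/-- If `M` maps the vector of variables to that of their `(q + 1)`-st powers, then `det M` has the
same coefficient at `∏ X i ^ q` as the determinant of the diagonal matrix with that property. -/
lemma coeff_det_eq_one_of_mulVec_X {R : Type*} [CommRing R] {n q : ℕ}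
    (M : Matrix (Fin n) (Fin n) (MvPolynomial (Fin n) R))
    (hM : ∀ j, ∑ h, M j h * X h = X j ^ (q + 1)) :
    coeff (Finsupp.equivFunOnFinite.symm fun _ => q) M.det = 1 := by
  classical
  let r : Fin n →₀ ℕ := Finsupp.equivFunOnFinite.symm fun _ => q
  let D : Matrix (Fin n) (Fin n) (MvPolynomial (Fin n) R) := Matrix.diagonal fun j => X j ^ q
  have hD : ∀ j, ∑ h, D j h * X h = X j ^ (q + 1) := fun j => by
    simp [D, Matrix.diagonal_apply, pow_succ]
  let N : Finset (Fin n) → Matrix (Fin n) (Fin n) (MvPolynomial (Fin n) R) := fun S =>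
    Matrix.of fun j => if j ∈ S then M j else D j
  have hN : ∀ S j, ∑ h, N S j h * X h = X j ^ (q + 1) := fun S j => by
    by_cases hj : j ∈ S
    · simpa [N, hj] using hM j
    · simpa [N, hj] using hD j
  have key : ∀ S, coeff r (N S).det = 1 := by
    intro S
    induction S using Finset.induction_on with
    | empty =>
      have h1 : N ∅ = D := by ext; simp [N]
      have h2 : ∏ j : Fin n, (X j : MvPolynomial (Fin n) R) ^ q = monomial r 1 := by
        rw [monomial_eq, Finsupp.prod_fintype _ _ (by simp)]
        simp [r]
      rw [h1, Matrix.det_diagonal, h2, coeff_monomial, if_pos rfl]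
    | insert j S hj ih =>
      let K := (N S).updateRow j (M j - D j)
      have hins : N (insert j S) = (N S).updateRow j (M j) := by
        ext i h
        by_cases hi : i = j
        · subst hi; simp [N]
        · simp [N, hi]
      have hself : (N S).updateRow j (D j) = N S := by
        have : N S j = D j := if_neg hj
        rw [← this, Matrix.updateRow_eq_self]
      have hdet : (N (insert j S)).det = K.det + (N S).det := by
        rw [hins, ← sub_add_cancel (M j) (D j), Matrix.det_updateRow_add, hself]
      have hK : ∀ i, (K.mulVec X) i = if i = j then 0 else X i ^ (q + 1) := by
        intro i
        by_cases hi : i = j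
        · subst hi
          simp [K, Matrix.mulVec, dotProduct, sub_mul, hM, hD]
        · simpa [K, Matrix.mulVec, dotProduct, hi] using hN S i
      have hadj : K.det * X j = ∑ i, K.adjugate j i * (K.mulVec X) i := by
        have := congrFun (Matrix.mulVec_mulVec X K.adjugate K) j
        rw [Matrix.adjugate_mul, Matrix.smul_mulVec, Matrix.one_mulVec] at this
        exact this.symm
      have hzero : coeff r K.det = 0 := by
        rw [← coeff_mul_X r j, hadj, coeff_sum]
        refine Finset.sum_eq_zero fun i _ => ?_
        rw [hK]
        split_ifs with hi
        · simp
        · rw [X_pow_eq_monomial, coeff_mul_monomial', if_neg]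
          intro hle
          simpa [r, Ne.symm hi] using hle i
      rw [hdet, coeff_add, hzero, ih, zero_add]
  have : N Finset.univ = M := by ext; simp [N]
  rw [← this]
  exact key _

/-- Graded Nullstellensatz for forms without nontrivial common zero. -/
lemma exists_sum_mul_eq_X_pow {k : Type*} [Field k] [IsAlgClosed k] {n : ℕ}
    (f : Fin n → MvPolynomial (Fin n) k) (d : Fin n → ℕ) (hf : ∀ i, (f i).IsHomogeneous (d i))
    (hzero : ∀ x : Fin n → k, (∀ i, eval x (f i) = 0) → x = 0) :
    ∃ (q : ℕ) (a : Matrix (Fin n) (Fin n) (MvPolynomial (Fin n) k)),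
      (∀ j i, (a j i).totalDegree + d i ≤ q + 1) ∧ ∀ j, ∑ i, a j i * f i = X j ^ (q + 1) := by
  have hrad : ∀ j, ∃ m, (X j : MvPolynomial (Fin n) k) ^ m ∈ Ideal.span (Set.range f) := by
    intro j
    have : (X j : MvPolynomial (Fin n) k) ∈ (Ideal.span (Set.range f)).radical := by
      rw [← vanishingIdeal_zeroLocus_eq_radical (K := k)]
      intro x hx
      rw [zeroLocus_span] at hx
      have : x = 0 := hzero x fun i => by simpa [aeval_eq_eval] using hx (f i) ⟨i, rfl⟩
      simp [this]
    exact this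
  choose m hm using hrad
  let q := ∑ j, m j + ∑ i, d i
  have hmem : ∀ j, (X j : MvPolynomial (Fin n) k) ^ (q + 1) ∈ Ideal.span (Set.range f) := fun j =>
    Ideal.pow_mem_of_pow_mem _ (hm j) (by
      have := Finset.single_le_sum (f := m) (fun _ _ => Nat.zero_le _) (Finset.mem_univ j)
      omega)
  choose b hb using fun j => Ideal.mem_span_range_iff_exists_fun.1 (hmem j)
  have hd : ∀ i, d i ≤ q + 1 := fun i => by
    have := Finset.single_le_sum (f := d) (fun _ _ => Nat.zero_le _) (Finset.mem_univ i)
    omega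
  refine ⟨q, Matrix.of fun j i => homogeneousComponent (q + 1 - d i) (b j i), fun j i => ?_,
    fun j => ?_⟩
  · have := (homogeneousComponent_isHomogeneous (q + 1 - d i) (b j i)).totalDegree_le
    have := hd i
    simp only [Matrix.of_apply]
    omega
  · have h := congrArg (homogeneousComponent (q + 1)) (hb j)
    rw [homogeneousComponent_eq_self (isHomogeneous_X_pow j (q + 1)), map_sum] at h
    rw [← h]
    refine Finset.sum_congr rfl fun i _ => ?_
    change homogeneousComponent (q + 1 - d i) (b j i) * f i = _
    rw [← homogeneousComponent_mul_of_isHomogeneous (hf i), Nat.sub_add_cancel (hd i)]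

lemma totalDegree_sub_homogeneousComponent_le {σ R : Type*} [CommRing R] {p : MvPolynomial σ R}
    {e : ℕ} (hp : p.totalDegree ≤ e + 1) :
    (p - homogeneousComponent (e + 1) p).totalDegree ≤ e := by
  classical
  refine Finset.sup_le fun α hα => ?_
  rw [mem_support_iff, coeff_sub, coeff_homogeneousComponent] at hα
  by_contra! hlt
  change e < α.degree at hlt
  split_ifs at hα with h
  · simp at hα
  · rw [coeff_eq_zero_of_totalDegree_lt_degree (by omega)] at hα
    simp at hα

/-- The global residue: a functional annihilating the ideal of `F` and all polynomials of degree
less than `∑ i, (d i - 1)`, normalised on Bezoutian determinants. -/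
lemma exists_global_residue {k : Type*} [Field k] [IsAlgClosed k] {n : ℕ}
    (F : Fin n → MvPolynomial (Fin n) k) (e : Fin n → ℕ)
    (hF : ∀ i, (F i).totalDegree ≤ e i + 1)
    (hlead : ∀ x : Fin n → k,
      (∀ i, eval x (homogeneousComponent (e i + 1) (F i)) = 0) → x = 0) :
    ∃ ψ : MvPolynomial (Fin n) k →ₗ[k] k,
      (∀ g ∈ Ideal.span (Set.range F), ψ g = 0) ∧
      (∀ g, g.totalDegree < ∑ i, e i → ψ g = 0) ∧
      ∀ (ξ : Fin n → k) (θ : Matrix (Fin n) (Fin n) (MvPolynomial (Fin n) k)),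
        (∀ i h, (θ i h).totalDegree ≤ e i) →
        (∀ i, F i = ∑ h, θ i h * (X h - C (ξ h))) → ψ θ.det = 1 := by
  classical
  obtain ⟨q, a, ha, hsum⟩ := exists_sum_mul_eq_X_pow
    (fun i => homogeneousComponent (e i + 1) (F i)) (fun i => e i + 1)
    (fun i => homogeneousComponent_isHomogeneous _ _) hlead
  have ha' : ∀ j i, (a j i).totalDegree + e i ≤ q := fun j i => by have := ha j i; omega
  let L : Fin n → MvPolynomial (Fin n) k := fun j =>
    ∑ i, a j i * (F i - homogeneousComponent (e i + 1) (F i))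
  have hL : ∀ j, (L j).totalDegree ≤ q := fun j =>
    totalDegree_finsetSum_le fun i _ => (totalDegree_mul _ _).trans
      ((Nat.add_le_add_left (totalDegree_sub_homogeneousComponent_le (hF i)) _).trans (ha' j i))
  have hH : ∀ j, a.mulVec F j = X j ^ (q + 1) + L j := fun j => by
    simp only [L, Matrix.mulVec, dotProduct, mul_sub, Finset.sum_sub_distrib, hsum]
    ring
  obtain ⟨ρ, hρ, hρtop⟩ := exists_residue_functional L hL
  have hdeta : a.det.totalDegree + ∑ i, e i ≤ n * q := by
    rcases n.eq_zero_or_pos with rfl | hn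
    · simp
    have he : ∀ i, e i ≤ q := fun i => by have := ha' ⟨0, hn⟩ i; omega
    have h1 := totalDegree_det_le (M := a) (e := fun i => q - e i)
      fun j i => by have := ha' j i; omega
    have h2 : ∑ i, (q - e i) + ∑ i, e i = n * q := by
      rw [← Finset.sum_add_distrib]
      simp [Nat.sub_add_cancel, he]
    omega
  refine ⟨ρ ∘ₗ LinearMap.mulLeft k a.det, fun g hg => ?_, fun g hg => ?_, fun ξ θ hθ hθF => ?_⟩
  · obtain ⟨c, rfl⟩ := Ideal.mem_span_range_iff_exists_fun.1 hg
    simp only [LinearMap.comp_apply, LinearMap.mulLeft_apply, map_sum]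
    refine Finset.sum_eq_zero fun i _ => ?_
    have hadj : a.det * F i = ∑ j, a.adjugate i j * (a.mulVec F) j := by
      have := congrFun (Matrix.mulVec_mulVec F a.adjugate a) i
      rw [Matrix.adjugate_mul, Matrix.smul_mulVec, Matrix.one_mulVec] at this
      exact this.symm
    rw [mul_left_comm, hadj, Finset.mul_sum, map_sum]
    refine Finset.sum_eq_zero fun j _ => ?_
    rw [hH, ← mul_assoc, hρ]
  · have hdeg : (a.det * g).totalDegree < n * q := (totalDegree_mul _ _).trans_lt (by omega)
    rw [LinearMap.comp_apply, LinearMap.mulLeft_apply, hρtop _ hdeg.le,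
      coeff_eq_zero_of_totalDegree_lt_degree]
    simpa [Finsupp.degree_eq_sum] using hdeg
  · have hM : ∀ j h, ((a * θ) j h).totalDegree ≤ q := fun j h =>
      totalDegree_finsetSum_le fun i _ => (totalDegree_mul _ _).trans
        ((Nat.add_le_add_left (hθ i h) _).trans (ha' j i))
    have hMX : ∀ j, ∑ h, (a * θ) j h * (X h - C (ξ h)) = X j ^ (q + 1) + L j := fun j => by
      have h1 : θ.mulVec (fun h => X h - C (ξ h)) = F := funext fun i => (hθF i).symm
      rw [← hH, ← h1, Matrix.mulVec_mulVec]
      rfl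
    have hdet := homogeneousComponent_det_of_totalDegree_le hM
    rw [Fintype.card_fin] at hdet
    have hdeg : (a * θ).det.totalDegree ≤ n * q :=
      (totalDegree_det_le (e := fun _ => q) hM).trans (by simp)
    have htop := coeff_det_eq_one_of_mulVec_X ((a * θ).map (homogeneousComponent q)) (q := q)
      fun j => by
        have h := congrArg (homogeneousComponent (q + 1)) (hMX j)
        rw [map_add, homogeneousComponent_eq_self (isHomogeneous_X_pow j (q + 1)),
          homogeneousComponent_eq_zero _ _ (Nat.lt_succ_of_le (hL j)), add_zero, map_sum] at h
        rw [← h]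
        refine Finset.sum_congr rfl fun i _ => ?_
        rw [homogeneousComponent_mul_of_totalDegree_le (hM j i)
          ((totalDegree_sub_C_le _ _).trans (by simp)), map_sub,
          homogeneousComponent_eq_self (isHomogeneous_X k i),
          homogeneousComponent_eq_zero 1 (C (ξ i)) (by simp), sub_zero]
        rfl
    rw [LinearMap.comp_apply, LinearMap.mulLeft_apply, ← Matrix.det_mul, hρtop _ hdeg, ← htop,
      ← hdet, coeff_homogeneousComponent, if_pos (by simp [Finsupp.degree_eq_sum])]

/-- The matrix of divided differences of `F` at a common zero `ξ`. -/
lemma exists_bezoutian {R : Type*} [CommRing R] {n : ℕ}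
    (F : Fin n → MvPolynomial (Fin n) R) (e : Fin n → ℕ)
    (hF : ∀ i, (F i).totalDegree ≤ e i + 1) (ξ : Fin n → R) (hξ : ∀ i, eval ξ (F i) = 0) :
    ∃ θ : Matrix (Fin n) (Fin n) (MvPolynomial (Fin n) R),
      (∀ i h, (θ i h).totalDegree ≤ e i) ∧
      (∀ i, F i = ∑ h, θ i h * (X h - C (ξ h))) ∧
      eval ξ θ.det = eval ξ (Matrix.det (Matrix.of fun i h => pderiv h (F i))) ∧
      ∀ g, θ.det * (g - C (eval ξ g)) ∈ Ideal.span (Set.range F) := by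
  classical
  choose θ hθ hdeg using fun i => exists_sub_C_eval_eq_sum ξ (F i) (hF i)
  have hθF : ∀ i, F i = ∑ h, θ i h * (X h - C (ξ h)) := fun i => by simpa [hξ] using hθ i
  refine ⟨Matrix.of θ, hdeg, hθF, ?_, fun g => ?_⟩
  · rw [RingHom.map_det, RingHom.map_det]
    congr 1
    ext i h
    simp only [RingHom.mapMatrix_apply, Matrix.map_apply, Matrix.of_apply]
    conv_rhs => rw [hθF i]
    simp [pderiv_X, Pi.single_apply, apply_ite]
  · obtain ⟨γ, hγ, -⟩ := exists_sub_C_eval_eq_sum ξ g (Nat.le_succ _)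
    rw [hγ, Finset.mul_sum]
    refine Ideal.sum_mem _ fun h _ => ?_
    rw [mul_left_comm]
    refine Ideal.mul_mem_left _ _ ?_
    have h1 : (Matrix.of θ).mulVec (fun h => X h - C (ξ h)) = F := funext fun i => (hθF i).symm
    have := congrFun (Matrix.mulVec_mulVec (fun h => X h - C (ξ h)) (Matrix.of θ).adjugate
      (Matrix.of θ)) h
    rw [Matrix.adjugate_mul, Matrix.smul_mulVec, Matrix.one_mulVec, h1] at this
    change _ = (Matrix.of θ).det * (X h - C (ξ h)) at this
    rw [← this, Matrix.mulVec, dotProduct]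
    refine Ideal.sum_mem _ fun i _ => ?_
    exact Ideal.mul_mem_left _ _ (Ideal.subset_span (Set.mem_range_self i))

theorem stmt_14 (k : Type*) [Field k] [IsAlgClosed k] [CharZero k] (n : ℕ)
    (F : Fin n → MvPolynomial (Fin n) k) (d : Fin n → ℕ)
    (hd1 : ∀ i, 1 ≤ d i) (hdeg : ∀ i, (F i).totalDegree = d i)
    -- (i) the only common zero of the leading forms is the origin
    (hlead : ∀ x : Fin n → k,
      (∀ i, MvPolynomial.eval x (MvPolynomial.homogeneousComponent (d i) (F i)) = 0) →
        x = 0)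
    -- (ii) the set of common zeros of `F_1, …, F_n` is finite
    (hZfin : {x : Fin n → k | ∀ i, MvPolynomial.eval x (F i) = 0}.Finite)
    -- (iii) the Jacobian determinant is nonzero at every common zero
    (hJ : ∀ x ∈ {x : Fin n → k | ∀ i, MvPolynomial.eval x (F i) = 0},
      MvPolynomial.eval x
        (Matrix.det (Matrix.of fun i h => MvPolynomial.pderiv h (F i))) ≠ 0) :
    ∀ G : MvPolynomial (Fin n) k, G.totalDegree < (∑ i, d i) - n →
      ∑ ξ ∈ hZfin.toFinset,
        MvPolynomial.eval ξ G /
          MvPolynomial.eval ξ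
            (Matrix.det (Matrix.of fun i h => MvPolynomial.pderiv h (F i))) = 0 := by
  classical
  intro G hG
  obtain ⟨e, rfl⟩ : ∃ e : Fin n → ℕ, d = fun i => e i + 1 :=
    ⟨fun i => d i - 1, funext fun i => (Nat.sub_add_cancel (hd1 i)).symm⟩
  have hG' : G.totalDegree < ∑ i, e i := by
    simpa [Finset.sum_add_distrib] using hG
  have hF : ∀ i, (F i).totalDegree ≤ e i + 1 := fun i => (hdeg i).le
  obtain ⟨ψ, hψF, hψlow, hψdet⟩ := exists_global_residue F e hF hlead
  set J := Matrix.det (Matrix.of fun i h => pderiv h (F i))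
  set I := Ideal.span (Set.range F) with hI
  have hZ : ∀ ξ ∈ hZfin.toFinset, ∀ i, eval ξ (F i) = 0 := fun ξ hξ => by simpa using hξ
  have hvanish : ∀ g ∈ I, ∀ ξ ∈ hZfin.toFinset, eval ξ g = 0 := by
    intro g hg ξ hξ
    obtain ⟨c, rfl⟩ := Ideal.mem_span_range_iff_exists_fun.1 hg
    simp [hZ ξ hξ]
  have hJ0 : ∀ ξ ∈ hZfin.toFinset, eval ξ J ≠ 0 := fun ξ hξ => hJ ξ (hZ ξ hξ)
  have hE : ∀ ξ ∈ hZfin.toFinset, ∃ E : MvPolynomial (Fin n) k, ψ E = (eval ξ J)⁻¹ ∧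
      eval ξ E = 1 ∧ ∀ g, E * (g - C (eval ξ g)) ∈ I := by
    intro ξ hξ
    obtain ⟨θ, hθdeg, hθF, hθJ, hθI⟩ := exists_bezoutian F e hF ξ (hZ ξ hξ)
    refine ⟨C (eval ξ J)⁻¹ * θ.det, ?_, ?_, fun g => ?_⟩
    · rw [C_mul', map_smul, hψdet ξ θ hθdeg hθF, smul_eq_mul, mul_one]
    · rw [map_mul, eval_C, hθJ, inv_mul_cancel₀ (hJ0 ξ hξ)]
    · rw [mul_assoc]
      exact I.mul_mem_left _ (hθI g)
  choose! E hEψ hE1 hEI using hE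
  have hE0 : ∀ ξ ∈ hZfin.toFinset, ∀ η ∈ hZfin.toFinset, η ≠ ξ → eval η (E ξ) = 0 := by
    intro ξ hξ η hη hne
    obtain ⟨h, hh⟩ := Function.ne_iff.1 hne
    have := hvanish _ (hEI ξ hξ (X h)) η hη
    simpa [sub_ne_zero.2 hh] using this
  let u := ∑ ξ ∈ hZfin.toFinset, E ξ
  have hu : ∀ η ∈ hZfin.toFinset, eval η u = 1 := by
    intro η hη
    rw [map_sum, Finset.sum_eq_single η (fun ξ hξ hne => hE0 ξ hξ η hη hne.symm)
      (fun h => absurd hη h), hE1 η hη]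
  have hcomb : ∀ g, u * g - ∑ ξ ∈ hZfin.toFinset, E ξ * C (eval ξ g) ∈ I := by
    intro g
    rw [Finset.sum_mul, ← Finset.sum_sub_distrib]
    exact I.sum_mem fun ξ hξ => by rw [← mul_sub]; exact hEI ξ hξ g
  have hidem : u * (1 - u) ∈ I := by
    convert hcomb (1 - u) using 1
    rw [Finset.sum_eq_zero fun ξ hξ => by simp [hu ξ hξ], sub_zero]
  have hnil : 1 - u ∈ I.radical := by
    rw [← vanishingIdeal_zeroLocus_eq_radical (K := k)]
    intro x hx
    rw [hI, zeroLocus_span] at hx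
    have hxZ : x ∈ hZfin.toFinset := by
      simpa [aeval_eq_eval] using hx
    simp [aeval_eq_eval, hu x hxZ]
  have hone : 1 - u ∈ I := by
    obtain ⟨m, hm⟩ := hnil
    have hpow : ∀ m : ℕ, 1 - u - (1 - u) ^ (m + 1) ∈ I := by
      intro m
      induction m with
      | zero => simp
      | succ m ih =>
        have : 1 - u - (1 - u) ^ (m + 1 + 1) =
            (1 - u - (1 - u) ^ (m + 1)) + (1 - u) ^ m * (u * (1 - u)) := by ring
        rw [this]
        exact I.add_mem ih (I.mul_mem_left _ hidem)
    have := I.add_mem (hpow m) (Ideal.pow_mem_of_pow_mem I hm (Nat.le_succ m))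
    simpa using this
  have hGI : G - ∑ ξ ∈ hZfin.toFinset, E ξ * C (eval ξ G) ∈ I := by
    convert I.add_mem (I.mul_mem_left G hone) (hcomb G) using 1
    ring
  have hfinal := hψF _ hGI
  rw [map_sub, hψlow G hG', zero_sub, neg_eq_zero, map_sum] at hfinal
  refine (Finset.sum_congr rfl fun ξ hξ => ?_).trans hfinal
  rw [mul_comm, C_mul', map_smul, hEψ ξ hξ, smul_eq_mul, div_eq_mul_inv]
end

section
/- (Kernel of Kronecker's multivariate interpolation formula.) Let ξ_1, …, ξ_m be pairwise distinct points of kⁿ and let F_1, …, F_n ∈ k[x_1, …, x_n] vanish at every point ξ_j. Suppose that for a fixed index κ one is given polynomials F^{(κ)}_{h,i} ∈ k[x_1, …, x_n] (1 ≤ h, i ≤ n) such that F_i = ∑_{h=1}^{n} (x_h − ξ_{κ,h}) · F^{(κ)}_{h,i} for every i, and set D_κ = det(F^{(κ)}_{h,i})_{1≤h,i≤n}. Then D_κ vanishes at every point ξ_j with j ≠ κ. -/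
open MvPolynomial

theorem stmt_15 (k : Type*) [Field k] (n m : ℕ)
    (ξ : Fin m → (Fin n → k)) (hξ : Function.Injective ξ)
    (F : Fin n → MvPolynomial (Fin n) k)
    (hvanish : ∀ i j, MvPolynomial.eval (ξ j) (F i) = 0)
    (κ : Fin m) (Fκ : Fin n → Fin n → MvPolynomial (Fin n) k)
    (hre : ∀ i, F i =
      ∑ h, (MvPolynomial.X h - MvPolynomial.C (ξ κ h)) * Fκ h i) :
    ∀ j, j ≠ κ → MvPolynomial.eval (ξ j) (Matrix.det (Matrix.of Fκ)) = 0 := by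
  intro j hj
  rw [RingHom.map_det]
  refine Matrix.exists_vecMul_eq_zero_iff.mp ⟨ξ j - ξ κ, ?_, ?_⟩
  · exact sub_ne_zero.mpr fun h => hj (hξ h)
  · ext i
    have h := hvanish i j
    rw [hre i] at h
    simpa [Matrix.vecMul, dotProduct] using h
end

section
/- Let n ≥ 1 and let x_1, …, x_n be elements of a commutative ring R. Consider the n! × n! matrix whose rows are indexed by the tuples (h_1, …, h_{n−1}) with 0 ≤ h_κ ≤ n−κ for κ = 1, …, n−1, whose columns are indexed by the permutations σ of {1, …, n}, and whose (h, σ)-entry is the monomial x_{σ(1)}^{h_1} · x_{σ(2)}^{h_2} · ⋯ · x_{σ(n−1)}^{h_{n−1}}. Then the square of its determinant equals (∏_{1 ≤ i < j ≤ n} (x_i − x_j))^{n!}. -/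
open scoped Kronecker

/-- The square of the determinant does not depend on how rows and columns are identified. -/
theorem Matrix.det_submatrix_equiv_sq {R k l m n : Type*} [CommRing R]
    [Fintype k] [DecidableEq k] [Fintype l] [DecidableEq l]
    (A : Matrix m n R) (e₁ : k ≃ m) (e₂ : k ≃ n) (f₁ : l ≃ m) (f₂ : l ≃ n) :
    (A.submatrix e₁ e₂).det ^ 2 = (A.submatrix f₁ f₂).det ^ 2 := by
  set g : k ≃ l := e₂.trans f₂.symm
  set p : Equiv.Perm l := g.symm.trans (e₁.trans f₁.symm)
  have h : A.submatrix e₁ e₂ = ((A.submatrix f₁ f₂).submatrix p id).submatrix g g := by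
    ext i j
    simp [p, g]
  rw [h, Matrix.det_submatrix_equiv_self, Matrix.det_permute, mul_pow]
  rcases Int.units_eq_one_or (Equiv.Perm.sign p) with hp | hp <;> simp [hp]

/-- Permutations of `Fin (n + 1)` as pairs of the image of `0` and a permutation of `Fin n`,
identifying the complement of that image with `Fin n` in the order-preserving way. -/
theorem exists_perm_succAbove_equiv (n : ℕ) :
    ∃ F : Equiv.Perm (Fin n) × Fin (n + 1) ≃ Equiv.Perm (Fin (n + 1)),
      ∀ p, F p 0 = p.2 ∧ ∀ k : Fin n, F p k.succ = p.2.succAbove (p.1 k) := by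
  let F : Equiv.Perm (Fin n) × Fin (n + 1) → Equiv.Perm (Fin (n + 1)) := fun p =>
    (Equiv.Perm.decomposeFin.symm (0, p.1)).trans p.2.cycleRange.symm
  have h : ∀ p, F p 0 = p.2 ∧ ∀ k : Fin n, F p k.succ = p.2.succAbove (p.1 k) := by
    intro p
    simp [F]
  have hF : Function.Bijective F := by
    rw [Fintype.bijective_iff_injective_and_card]
    constructor
    · rintro ⟨σ, i⟩ ⟨τ, j⟩ hst
      obtain rfl : i = j := by
        exact (h (σ, i)).1.symm.trans (hst ▸ (h (τ, j)).1)
      congr 1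
      ext k : 1
      apply Fin.succAbove_right_injective (p := i)
      rw [← (h (σ, i)).2, hst, (h (τ, i)).2]
    · simp [Fintype.card_perm, Nat.factorial_succ, mul_comm]
  exact ⟨Equiv.ofBijective F hF, h⟩

theorem exists_cons_equiv (n : ℕ) :
    ∃ G : ((κ : Fin n) → Fin (n - (κ : ℕ))) × Fin (n + 1) ≃
        ((κ : Fin (n + 1)) → Fin (n + 1 - (κ : ℕ))),
      ∀ p, (G p 0 : ℕ) = p.2 ∧ ∀ k : Fin n, (G p k.succ : ℕ) = p.1 k := by
  refine ⟨(Equiv.prodComm _ _).trans (((Equiv.refl _).prodCongr (Equiv.piCongrRight fun k =>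
    finCongr (by simp))).trans (Fin.consEquiv fun κ : Fin (n + 1) => Fin (n + 1 - (κ : ℕ)))), ?_⟩
  exact fun p => ⟨rfl, fun k => rfl⟩

/-- The product of the differences of the entries of `x`. -/
def differenceProduct {R : Type*} [CommRing R] {n : ℕ} (x : Fin n → R) : R :=
  ∏ i : Fin n, ∏ j ∈ Finset.Ioi i, (x i - x j)

theorem det_vandermonde_sq {R : Type*} [CommRing R] {n : ℕ} (x : Fin n → R) :
    (Matrix.vandermonde x).det ^ 2 = differenceProduct x ^ 2 := by
  simp only [Matrix.det_vandermonde, differenceProduct, ← Finset.prod_pow]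
  exact Finset.prod_congr rfl fun i _ => Finset.prod_congr rfl fun j _ => by ring

theorem differenceProduct_eq_prod_ite {R : Type*} [CommRing R] {n : ℕ} (x : Fin n → R) :
    differenceProduct x = ∏ a, ∏ b, if a < b then x a - x b else 1 := by
  refine Finset.prod_congr rfl fun a _ => ?_
  rw [← Finset.prod_filter]
  congr 1
  ext b
  simp

theorem differenceProduct_sq_mul_prod_succAbove {R : Type*} [CommRing R] {n : ℕ}
    (x : Fin (n + 1) → R) :
    differenceProduct x ^ 2 * ∏ i : Fin (n + 1), differenceProduct (x ∘ i.succAbove) =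
      differenceProduct x ^ (n + 1) := by
  have h (i : Fin (n + 1)) : differenceProduct (x ∘ i.succAbove) =
      ∏ a, ∏ b, if a ≠ i ∧ b ≠ i then (if a < b then x a - x b else 1) else 1 := by
    rw [differenceProduct_eq_prod_ite, Fin.prod_univ_succAbove _ i]
    simp [Fin.prod_univ_succAbove _ i]
  simp only [h]
  rw [Finset.prod_comm, Finset.prod_congr rfl fun a _ => Finset.prod_comm]
  simp only [differenceProduct_eq_prod_ite, ← Finset.prod_pow, ← Finset.prod_mul_distrib]
  refine Finset.prod_congr rfl fun a _ => ?_
  refine Finset.prod_congr rfl fun b _ => ?_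
  split_ifs with hab
  · rw [← Finset.prod_filter, Finset.prod_const, ← pow_add]
    congr 1
    have h₁ : (Finset.univ.filter fun i => a ≠ i ∧ b ≠ i) = ({a, b} : Finset (Fin (n + 1)))ᶜ := by
      ext i
      simp [eq_comm]
    have h₂ := Finset.card_add_card_compl ({a, b} : Finset (Fin (n + 1)))
    rw [Finset.card_pair hab.ne, Fintype.card_fin] at h₂
    rw [h₁, h₂]
  · simp

/-- The matrix of the monomials `∏ κ, x (σ κ) ^ h κ` with `h κ < n - κ`, indexed by exponent
tuples `h` and permutations `σ`. -/
def permMonomialMatrix {R : Type*} [CommRing R] {n : ℕ} (x : Fin n → R) :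
    Matrix ((κ : Fin n) → Fin (n - (κ : ℕ))) (Equiv.Perm (Fin n)) R :=
  Matrix.of fun h σ => ∏ κ, x (σ κ) ^ (h κ : ℕ)

theorem exists_det_permMonomialMatrix_sq (R : Type*) [CommRing R] (n : ℕ) :
    ∃ e : Equiv.Perm (Fin n) ≃ ((κ : Fin n) → Fin (n - (κ : ℕ))), ∀ x : Fin n → R,
      ((permMonomialMatrix x).submatrix e id).det ^ 2 = differenceProduct x ^ n.factorial := by
  induction n with
  | zero =>
    refine ⟨Equiv.ofUnique _ _, fun x => ?_⟩
    simp [differenceProduct, permMonomialMatrix, Matrix.det_unique]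
  | succ n ih =>
    obtain ⟨e, he⟩ := ih
    obtain ⟨F, hF⟩ := exists_perm_succAbove_equiv n
    obtain ⟨G, hG⟩ := exists_cons_equiv n
    set E := (e.prodCongr (Equiv.refl (Fin (n + 1)))).trans G with hE
    refine ⟨F.symm.trans E, fun x => ?_⟩
    have hfac : (permMonomialMatrix x).submatrix E F =
        ((1 : Matrix (Equiv.Perm (Fin n)) _ R) ⊗ₖ (Matrix.vandermonde x).transpose) *
          Matrix.blockDiagonal fun i : Fin (n + 1) =>
            (permMonomialMatrix (x ∘ i.succAbove)).submatrix e id := by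
      ext ⟨σ, h⟩ ⟨τ, i⟩
      simp [Matrix.mul_apply, Fintype.sum_prod_type, Matrix.blockDiagonal_apply,
        Matrix.one_apply, permMonomialMatrix, Fin.prod_univ_succ, hF, hG, hE,
        Matrix.vandermonde_apply]
    have h := Matrix.det_submatrix_equiv_sq (permMonomialMatrix x) (F.symm.trans E)
      (Equiv.refl _) E F
    rw [Equiv.coe_refl] at h
    rw [h, hfac, Matrix.det_mul, Matrix.det_kronecker, Matrix.det_blockDiagonal,
      Matrix.det_transpose, mul_pow, ← Finset.prod_pow]
    simp only [he, Matrix.det_one, one_pow, one_mul, Fintype.card_perm, Fintype.card_fin]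
    rw [← pow_mul, mul_comm, mul_comm n.factorial, pow_mul, det_vandermonde_sq,
      Finset.prod_pow, mul_comm, ← mul_pow, differenceProduct_sq_mul_prod_succAbove,
      ← pow_mul, Nat.factorial_succ]

theorem stmt_16 (R : Type*) [CommRing R] (n : ℕ) (hn : 1 ≤ n) (x : Fin n → R)
    (e : ((κ : Fin (n - 1)) → Fin (n - (κ : ℕ))) ≃ Equiv.Perm (Fin n)) :
    (Matrix.det (Matrix.of fun σ τ : Equiv.Perm (Fin n) =>
        ∏ κ : Fin (n - 1), x (τ (Fin.castLE (Nat.sub_le n 1) κ)) ^ ((e.symm σ) κ : ℕ))) ^ 2 =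
      (∏ i : Fin n, ∏ j ∈ Finset.Ioi i, (x i - x j)) ^ n.factorial := by
  obtain ⟨m, rfl⟩ : ∃ m, n = m + 1 := ⟨n - 1, by omega⟩
  obtain ⟨e', he'⟩ := exists_det_permMonomialMatrix_sq R (m + 1)
  have hlast : Unique (Fin (m + 1 - (Fin.last m : ℕ))) :=
    (finCongr (by simp : m + 1 - (Fin.last m : ℕ) = 1)).unique
  let S : ((κ : Fin m) → Fin (m + 1 - (κ : ℕ))) ≃
      ((κ : Fin (m + 1)) → Fin (m + 1 - (κ : ℕ))) :=
    (Equiv.uniqueProd _ _).symm.trans (Fin.snocEquiv fun κ : Fin (m + 1) => Fin (m + 1 - (κ : ℕ)))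
  have hS (h) (k : Fin m) : (S h k.castSucc : ℕ) = h k := by
    simp [S, Fin.snocEquiv]
  have hS' (h) : (S h (Fin.last m) : ℕ) = 0 := by
    have := (S h (Fin.last m)).isLt
    simp only [Fin.val_last] at this
    omega
  rw [← differenceProduct, ← he' x, ← Equiv.coe_refl,
    Matrix.det_submatrix_equiv_sq _ e' _ (e.symm.trans S) (Equiv.refl _)]
  congr 2
  ext σ τ
  simp only [Matrix.of_apply, Matrix.submatrix_apply, permMonomialMatrix, Fin.prod_univ_castSucc,
    Equiv.trans_apply, hS, hS', pow_zero, mul_one, Equiv.refl_apply]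
  rfl
end

section
/- Let K = ℚ(√−23), i.e., K = ℚ(α) where α is a root of X² + 23. Then the ideal class group of the ring of integers 𝓞_K of K has exactly 3 elements. -/
open NumberField

/-- The order `ℤ[ω]` with `ω² = ω - 6`, of discriminant `-23`. -/
abbrev QuadraticOrder23 : Type := QuadraticAlgebra ℤ (-6) 1

namespace QuadraticOrder23

open QuadraticAlgebra nonZeroDivisors

lemma four_mul_norm (z : QuadraticOrder23) :
    4 * norm z = (2 * z.re + z.im) ^ 2 + 23 * z.im ^ 2 := by
  rw [norm_def]; ring

lemma norm_pos {z : QuadraticOrder23} (hz : z ≠ 0) : 0 < norm z := by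
  have h := four_mul_norm z
  by_contra! hle
  have him : z.im = 0 := by
    by_contra hne
    have := sq_pos_of_ne_zero hne
    nlinarith [sq_nonneg (2 * z.re + z.im)]
  have hre : z.re = 0 := by
    by_contra hne
    have := sq_pos_of_ne_zero hne
    simp only [him] at h
    nlinarith
  exact hz (QuadraticAlgebra.ext hre him)

/-- Multiplying an integer by `1` or `2` brings it within `n / 3` of a multiple of `n`. -/
lemma exists_three_mul_abs_le (v : ℤ) {n : ℤ} (hn : 0 < n) :
    ∃ t : ℤ, (t = 1 ∨ t = 2) ∧ ∃ q : ℤ, 3 * |t * v - q * n| ≤ n := by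
  have h0 := Int.emod_nonneg v hn.ne'
  have h1 := Int.emod_lt_of_pos v hn
  have h2 := Int.emod_add_mul_ediv v n
  set r := v % n
  set k := v / n
  rcases le_or_gt (3 * r) n with h | h
  · refine ⟨1, .inl rfl, k, ?_⟩
    rw [show 1 * v - k * n = r by linarith, abs_of_nonneg h0]
    exact h
  rcases le_or_gt (2 * n) (3 * r) with h' | h'
  · refine ⟨1, .inl rfl, k + 1, ?_⟩
    rw [show 1 * v - (k + 1) * n = r - n by linarith, abs_of_nonpos (by linarith)]
    linarith
  · refine ⟨2, .inr rfl, 2 * k + 1, ?_⟩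
    rw [show 2 * v - (2 * k + 1) * n = 2 * r - n by linarith]
    have : |2 * r - n| * 3 ≤ n := by
      rcases abs_cases (2 * r - n) with ⟨h, -⟩ | ⟨h, -⟩ <;> rw [h] <;> linarith
    linarith

lemma exists_two_mul_add_abs_le (u : ℤ) {n : ℤ} (hn : 0 < n) :
    ∃ q : ℤ, |u - 2 * (q * n)| ≤ n := by
  have h0 := Int.emod_nonneg u (b := 2 * n) (by positivity)
  have h1 := Int.emod_lt_of_pos u (b := 2 * n) (by positivity)
  have h2 := Int.emod_add_mul_ediv u (2 * n)
  set r := u % (2 * n)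
  set k := u / (2 * n)
  rcases le_or_gt r n with h | h
  · refine ⟨k, ?_⟩
    rw [show u - 2 * (k * n) = r by linarith, abs_of_nonneg h0]
    exact h
  · refine ⟨k + 1, ?_⟩
    rw [show u - 2 * ((k + 1) * n) = r - 2 * n by linarith, abs_of_nonpos (by linarith)]
    linarith

/-- A weak form of division with remainder. -/
lemma exists_norm_sub_lt (a : QuadraticOrder23) {b : QuadraticOrder23} (hb : b ≠ 0) :
    ∃ t : ℤ, (t = 1 ∨ t = 2) ∧ ∃ q : QuadraticOrder23,
      norm ((t : QuadraticOrder23) * a - q * b) < norm b := by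
  have hn := norm_pos hb
  set n := norm b with hn_def
  set w := a * star b with hw
  obtain ⟨t, ht, y, hy⟩ := exists_three_mul_abs_le w.im hn
  obtain ⟨x, hx⟩ := exists_two_mul_add_abs_le (2 * (t * w.re) + (t * w.im - y * n)) hn
  refine ⟨t, ht, ⟨x, y⟩, ?_⟩
  set q : QuadraticOrder23 := ⟨x, y⟩ with hq
  have key : ((t : QuadraticOrder23) * a - q * b) * star b
      = (t : QuadraticOrder23) * w - q * (n : QuadraticOrder23) := by
    have : (n : QuadraticOrder23) = b * star b := by
      rw [← algebraMap_norm_eq_mul_star]; simp [hn_def]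
    rw [this, hw]; ring
  have hnorm := congrArg QuadraticAlgebra.norm key
  rw [map_mul, QuadraticAlgebra.norm_star, ← hn_def] at hnorm
  have h4 := four_mul_norm ((t : QuadraticOrder23) * w - q * (n : QuadraticOrder23))
  have him : ((t : QuadraticOrder23) * w - q * (n : QuadraticOrder23)).im
      = t * w.im - y * n := by simp [hq]
  have hre : ((t : QuadraticOrder23) * w - q * (n : QuadraticOrder23)).re
      = t * w.re - x * n := by simp [hq]
  rw [him, hre, ← hnorm] at h4
  have hx' : (2 * (t * w.re - x * n) + (t * w.im - y * n)) ^ 2 ≤ n ^ 2 := by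
    rw [sq_le_sq, abs_of_pos hn]
    rwa [show 2 * (t * w.re - x * n) + (t * w.im - y * n)
      = 2 * (t * w.re) + (t * w.im - y * n) - 2 * (x * n) by ring]
  have hy' : (3 * (t * w.im - y * n)) ^ 2 ≤ n ^ 2 := by
    rw [sq_le_sq, abs_of_pos hn, abs_mul]
    simpa using hy
  nlinarith

lemma exists_two_mul_mem_span {I : Ideal QuadraticOrder23} (hI : I ≠ ⊥) :
    ∃ b ∈ I, b ≠ 0 ∧ ∀ a ∈ I, 2 * a ∈ Ideal.span {b} := by
  obtain ⟨c, hc, hc0⟩ := Submodule.exists_mem_ne_zero_of_ne_bot hI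
  obtain ⟨b, ⟨hb, hb0⟩, hmin⟩ := (measure fun z : QuadraticOrder23 ↦ (norm z).toNat).wf.has_min
    {z | z ∈ I ∧ z ≠ 0} ⟨c, hc, hc0⟩
  refine ⟨b, hb, hb0, fun a ha ↦ ?_⟩
  obtain ⟨t, ht, q, hq⟩ := exists_norm_sub_lt a hb0
  have hzero : (t : QuadraticOrder23) * a - q * b = 0 := by
    by_contra hne
    refine hmin _ ⟨I.sub_mem (I.mul_mem_left _ ha) (I.mul_mem_left _ hb), hne⟩ ?_
    exact (Int.toNat_lt_toNat (norm_pos hb0)).mpr hq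
  have hmem : (t : QuadraticOrder23) * a ∈ Ideal.span {b} :=
    Ideal.mem_span_singleton'.mpr ⟨q, (sub_eq_zero.mp hzero).symm⟩
  rcases ht with rfl | rfl
  · exact Ideal.mul_mem_left _ _ (by simpa using hmem)
  · simpa using hmem

lemma exists_mk0_eq_two_mem [IsDedekindDomain QuadraticOrder23]
    (C : ClassGroup QuadraticOrder23) :
    ∃ J : (Ideal QuadraticOrder23)⁰, (2 : QuadraticOrder23) ∈ (J : Ideal QuadraticOrder23) ∧
      ClassGroup.mk0 J = C := by
  obtain ⟨I, rfl⟩ := ClassGroup.mk0_surjective C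
  obtain ⟨b, hb, hb0, h⟩ := exists_two_mul_mem_span (nonZeroDivisors.ne_zero I.2)
  have h2 : (2 : QuadraticOrder23) ≠ 0 := fun h ↦ by simpa using congrArg re h
  have hle : Ideal.span {2} * (I : Ideal QuadraticOrder23) ≤ Ideal.span {b} := by
    intro x hx
    obtain ⟨z, hz, rfl⟩ := Ideal.mem_span_singleton_mul.mp hx
    exact h z hz
  obtain ⟨J, hJ⟩ := Ideal.dvd_iff_le.mpr hle
  have h2J : (2 : QuadraticOrder23) ∈ J := by
    have : 2 * b ∈ Ideal.span {b} * J := hJ ▸ Ideal.mem_span_singleton_mul.mpr ⟨b, hb, rfl⟩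
    obtain ⟨z, hz, hzb⟩ := Ideal.mem_span_singleton_mul.mp this
    rwa [← mul_left_cancel₀ hb0 (hzb.trans (mul_comm _ _))]
  have hJ0 : J ≠ 0 := fun h ↦ h2 (by rwa [h, Ideal.zero_eq_bot, Ideal.mem_bot] at h2J)
  exact ⟨⟨J, mem_nonZeroDivisors_of_ne_zero hJ0⟩, h2J,
    ClassGroup.mk0_eq_mk0_iff.mpr ⟨b, 2, hb0, h2, hJ.symm⟩⟩

lemma one_mem_of_odd {J : Ideal QuadraticOrder23} (h2 : (2 : QuadraticOrder23) ∈ J) {m : ℤ}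
    (hm : Odd m) (h : (m : QuadraticOrder23) ∈ J) : (1 : QuadraticOrder23) ∈ J := by
  obtain ⟨k, rfl⟩ := hm
  have := J.sub_mem h (J.mul_mem_left (k : QuadraticOrder23) h2)
  convert this using 1
  push_cast
  ring

lemma eq_add_mul_omega (z : QuadraticOrder23) :
    z = (z.re : QuadraticOrder23) + (z.im : QuadraticOrder23) * ω := by
  ext <;> simp

lemma mem_of_even {J : Ideal QuadraticOrder23} (h2 : (2 : QuadraticOrder23) ∈ J) {m : ℤ}
    (hm : Even m) : (m : QuadraticOrder23) ∈ J := by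
  obtain ⟨k, rfl⟩ := hm
  convert J.mul_mem_left (k : QuadraticOrder23) h2 using 1
  push_cast
  ring

lemma eq_of_two_mem {J : Ideal QuadraticOrder23} (h2 : (2 : QuadraticOrder23) ∈ J) :
    J = ⊤ ∨ J = Ideal.span {2} ∨ J = Ideal.span {2, ω} ∨ J = Ideal.span {2, 1 + ω} := by
  by_cases h1 : (1 : QuadraticOrder23) ∈ J
  · exact .inl ((Ideal.eq_top_iff_one J).mpr h1)
  have heven {m : ℤ} (h : (m : QuadraticOrder23) ∈ J) : Even m := by
    by_contra hm
    exact h1 (one_mem_of_odd h2 (Int.not_even_iff_odd.mp hm) h)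
  refine .inr ?_
  by_cases hω : ω ∈ J
  · refine .inr (.inl (le_antisymm (fun x hx ↦ ?_) ?_))
    · have hre : Even x.re := heven <| by
        convert J.sub_mem hx (J.mul_mem_left (x.im : QuadraticOrder23) hω) using 1
        linear_combination -(eq_add_mul_omega x)
      rw [eq_add_mul_omega x]
      exact Ideal.add_mem _ (mem_of_even (Ideal.subset_span (by simp)) hre)
        (Ideal.mul_mem_left _ _ (Ideal.subset_span (by simp)))
    · rw [Ideal.span_le]
      rintro x (rfl | rfl) <;> assumption
  by_cases hω' : 1 + ω ∈ J
  · refine .inr (.inr (le_antisymm (fun x hx ↦ ?_) ?_))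
    · have hx' : x = ((x.re - x.im : ℤ) : QuadraticOrder23)
          + (x.im : QuadraticOrder23) * (1 + ω) := by
        push_cast
        linear_combination eq_add_mul_omega x
      have hre : Even (x.re - x.im) := heven <| by
        convert J.sub_mem hx (J.mul_mem_left (x.im : QuadraticOrder23) hω') using 1
        linear_combination -hx'
      rw [hx']
      exact Ideal.add_mem _ (mem_of_even (Ideal.subset_span (by simp)) hre)
        (Ideal.mul_mem_left _ _ (Ideal.subset_span (by simp)))
    · rw [Ideal.span_le]
      rintro x (rfl | rfl) <;> assumption
  · refine .inl (le_antisymm (fun x hx ↦ ?_) ?_)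
    · have h2' : (2 : QuadraticOrder23) ∈ Ideal.span {(2 : QuadraticOrder23)} :=
        Ideal.mem_span_singleton_self 2
      have him : Even x.im := by
        by_contra him
        obtain ⟨k, hk⟩ := Int.not_even_iff_odd.mp him
        have hsub : (x.re : QuadraticOrder23) + ω ∈ J := by
          convert J.sub_mem hx (J.mul_mem_left ((k : QuadraticOrder23) * ω) h2) using 1
          have := eq_add_mul_omega x
          rw [hk] at this
          push_cast at this
          linear_combination -this
        rcases Int.even_or_odd x.re with hre | hre
        · exact hω (by simpa using J.sub_mem hsub (mem_of_even h2 hre))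
        · refine hω' ?_
          convert J.sub_mem hsub (mem_of_even h2 (hre.sub_odd odd_one)) using 1
          push_cast
          ring
      have hre : Even x.re := heven <| by
        convert J.sub_mem hx (J.mul_mem_left ω (mem_of_even h2 him)) using 1
        linear_combination -(eq_add_mul_omega x)
      rw [eq_add_mul_omega x]
      exact Ideal.add_mem _ (mem_of_even h2' hre) (Ideal.mul_mem_right _ _ (mem_of_even h2' him))
    · rw [Ideal.span_le]
      rintro x rfl
      exact h2

lemma one_notMem_span_two_omega :
    (1 : QuadraticOrder23) ∉ Ideal.span {(2 : QuadraticOrder23), ω} := by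
  rw [Ideal.mem_span_pair]
  rintro ⟨a, b, h⟩
  have := congrArg re h
  simp at this
  omega

lemma norm_ne_two (z : QuadraticOrder23) : norm z ≠ 2 := by
  intro h
  have h4 := four_mul_norm z
  have him : z.im = 0 := by
    by_contra hne
    have := sq_pos_of_ne_zero hne
    nlinarith [sq_nonneg (2 * z.re + z.im)]
  rw [him, h] at h4
  have h1 : z.re < 2 := by nlinarith
  have h2 : -2 < z.re := by nlinarith
  interval_cases z.re <;> omega

lemma eq_of_norm_eq_four {z : QuadraticOrder23} (h : norm z = 4) : z = 2 ∨ z = -2 := by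
  have h4 := four_mul_norm z
  have him : z.im = 0 := by
    by_contra hne
    have := sq_pos_of_ne_zero hne
    nlinarith [sq_nonneg (2 * z.re + z.im)]
  have hre : z.re ^ 2 = 2 ^ 2 := by
    rw [him, h] at h4
    linarith
  rcases sq_eq_sq_iff_eq_or_eq_neg.mp hre with hre | hre
  · exact .inl (QuadraticAlgebra.ext hre him)
  · exact .inr (QuadraticAlgebra.ext hre him)

lemma span_singleton_eq_top_of_norm_eq_one {c : QuadraticOrder23} (h : norm c = 1) :
    Ideal.span {c} = ⊤ := by
  rw [Ideal.span_singleton_eq_top, isUnit_iff_norm_isUnit, h]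
  exact isUnit_one

lemma not_isPrincipal_span_two_omega :
    ¬ (Ideal.span {(2 : QuadraticOrder23), ω}).IsPrincipal := by
  rintro ⟨c, hc⟩
  rw [Ideal.submodule_span_eq] at hc
  have h2 : c ∣ 2 := by
    rw [← Ideal.mem_span_singleton, ← hc]; exact Ideal.subset_span (by simp)
  have hω : c ∣ ω := by
    rw [← Ideal.mem_span_singleton, ← hc]; exact Ideal.subset_span (by simp)
  have hc0 : c ≠ 0 := by
    rintro rfl
    simpa using congrArg re (zero_dvd_iff.mp h2)
  have hpos := norm_pos hc0
  have h4 : norm c ∣ 4 := by simpa [norm_def] using map_dvd QuadraticAlgebra.norm h2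
  have h6 : norm c ∣ 6 := by simpa [norm_def] using map_dvd QuadraticAlgebra.norm hω
  have hd : norm c ∣ 2 := by simpa using dvd_sub h6 h4
  have hle := Int.le_of_dvd (by norm_num) hd
  have hne := norm_ne_two c
  refine one_notMem_span_two_omega ?_
  rw [hc, span_singleton_eq_top_of_norm_eq_one (by omega)]
  trivial

lemma not_isPrincipal_span_two_omega_sq :
    ¬ (Ideal.span {(2 : QuadraticOrder23), ω} * Ideal.span {2, ω}).IsPrincipal := by
  rintro ⟨c, hc⟩
  rw [Ideal.submodule_span_eq] at hc
  have hmem2 : (2 : QuadraticOrder23) ∈ Ideal.span {(2 : QuadraticOrder23), ω} :=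
    Ideal.subset_span (by simp)
  have hmemω : ω ∈ Ideal.span {(2 : QuadraticOrder23), ω} := Ideal.subset_span (by simp)
  have h2 : c ∣ 2 * 2 := by
    rw [← Ideal.mem_span_singleton, ← hc]; exact Ideal.mul_mem_mul hmem2 hmem2
  have hω : c ∣ ω * ω := by
    rw [← Ideal.mem_span_singleton, ← hc]; exact Ideal.mul_mem_mul hmemω hmemω
  have hc0 : c ≠ 0 := by
    rintro rfl
    simpa using congrArg re (zero_dvd_iff.mp h2)
  have hpos := norm_pos hc0
  have h16 : norm c ∣ 16 := by simpa [norm_def] using map_dvd QuadraticAlgebra.norm h2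
  have h36 : norm c ∣ 36 := by simpa [norm_def] using map_dvd QuadraticAlgebra.norm hω
  have hd : norm c ∣ 4 := by simpa using dvd_sub h36 (h16.mul_left 2)
  have hle := Int.le_of_dvd (by norm_num) hd
  have hne := norm_ne_two c
  have hcases : norm c = 1 ∨ norm c = 4 := by
    generalize norm c = n at *
    interval_cases n <;> omega
  rcases hcases with h | h
  · refine one_notMem_span_two_omega (Ideal.mul_le_left (J := Ideal.span {2, ω}) ?_)
    rw [hc, span_singleton_eq_top_of_norm_eq_one h]
    trivial
  · obtain ⟨w, hw⟩ := hω
    have him := congrArg im hw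
    rcases eq_of_norm_eq_four h with rfl | rfl <;> simp at him <;> omega

lemma span_two_omega_mul_span_two_one_add_omega :
    Ideal.span {(2 : QuadraticOrder23), ω} * Ideal.span {2, 1 + ω} = Ideal.span {2} := by
  apply le_antisymm
  · rw [Ideal.span_pair_mul_span_pair, Ideal.span_le]
    rintro x (rfl | rfl | rfl | rfl)
    · exact Ideal.mem_span_singleton.mpr (dvd_mul_right _ _)
    · exact Ideal.mem_span_singleton.mpr (dvd_mul_right _ _)
    · exact Ideal.mem_span_singleton.mpr (dvd_mul_left _ _)
    · exact Ideal.mem_span_singleton.mpr ⟨ω - 3, by ext <;> simp⟩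
  · rw [Ideal.span_le, Set.singleton_subset_iff, Ideal.span_pair_mul_span_pair]
    have h : 2 * (1 + ω) - ω * 2 ∈ Ideal.span
        {(2 : QuadraticOrder23) * 2, 2 * (1 + ω), ω * 2, ω * (1 + ω)} :=
      Ideal.sub_mem _ (Ideal.subset_span (by simp)) (Ideal.subset_span (by simp))
    rwa [show (2 : QuadraticOrder23) * (1 + ω) - ω * 2 = 2 by ring] at h

theorem card_classGroup [IsDedekindDomain QuadraticOrder23] :
    Nat.card (ClassGroup QuadraticOrder23) = 3 := by
  have h2 : (2 : QuadraticOrder23) ≠ 0 := fun h ↦ by simpa using congrArg re h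
  have hmem (x : QuadraticOrder23) : Ideal.span {2, x} ∈ (Ideal QuadraticOrder23)⁰ := by
    refine mem_nonZeroDivisors_of_ne_zero fun h ↦ h2 ?_
    rw [← Ideal.mem_bot, ← Ideal.zero_eq_bot, ← h]
    exact Ideal.subset_span (by simp)
  set p := ClassGroup.mk0 ⟨_, hmem ω⟩ with hp
  have hp1 : p ≠ 1 := fun h ↦
    not_isPrincipal_span_two_omega ((ClassGroup.mk0_eq_one_iff _).mp h)
  have hp2 : p * p ≠ 1 := fun h ↦ by
    rw [hp, ← map_mul] at h
    exact not_isPrincipal_span_two_omega_sq ((ClassGroup.mk0_eq_one_iff _).mp h)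
  have hinv : ClassGroup.mk0 ⟨_, hmem (1 + ω)⟩ = p⁻¹ :=
    ClassGroup.mk0_eq_mk0_inv_iff.mpr
      ⟨2, h2, (mul_comm _ _).trans span_two_omega_mul_span_two_one_add_omega⟩
  have huniv : (Set.univ : Set (ClassGroup QuadraticOrder23)) = {1, p, p⁻¹} := by
    refine (Set.eq_univ_of_forall fun C ↦ ?_).symm
    obtain ⟨⟨J, hJ⟩, h2J, rfl⟩ := exists_mk0_eq_two_mem C
    rcases eq_of_two_mem h2J with rfl | rfl | rfl | rfl
    · exact .inl ((ClassGroup.mk0_eq_one_iff _).mpr ⟨1, by simp⟩)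
    · exact .inl ((ClassGroup.mk0_eq_one_iff _).mpr ⟨2, rfl⟩)
    · exact .inr (.inl rfl)
    · exact .inr (.inr hinv)
  rw [← Set.ncard_univ, huniv, Set.ncard_eq_three]
  refine ⟨1, p, p⁻¹, hp1.symm, fun h ↦ hp1 (inv_eq_one.mp h.symm), fun h ↦ hp2 ?_, rfl⟩
  rw [← eq_inv_iff_mul_eq_one]
  exact h

end QuadraticOrder23

lemma IsDedekindDomain.of_ringEquiv {R S : Type*} [CommRing R] [CommRing S] [IsDedekindDomain R]
    (e : R ≃+* S) : IsDedekindDomain S where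
  toIsDomain := e.symm.toMulEquiv.isDomain
  toIsNoetherian := isNoetherianRing_of_ringEquiv R e
  maximalOfPrime {P} hP hPp := by
    have h : (P.comap (e : R →+* S)).IsMaximal := by
      refine (Ideal.IsPrime.comap _).isMaximal fun hbot ↦ hP ?_
      rw [eq_bot_iff]
      intro x hx
      have : e.symm x ∈ P.comap (e : R →+* S) := by
        rw [Ideal.mem_comap, RingEquiv.coe_toRingHom, e.apply_symm_apply]
        exact hx
      rw [hbot, Ideal.mem_bot] at this
      simpa using this
    rw [← Ideal.map_comap_of_surjective (e : R →+* S) e.surjective P]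
    exact Ideal.map_isMaximal_of_equiv e
  toIsIntegralClosure := by
    have := IsIntegrallyClosed.of_equiv e
    infer_instance

open QuadraticAlgebra in
/-- Integral elements of `ℚ(√-23)` have integral coordinates with respect to `1, (1 + √-23) / 2`. -/
lemma QuadraticAlgebra.exists_int_of_isIntegral {z : QuadraticAlgebra ℚ (-6) 1}
    (hz : IsIntegral ℤ z) : ∃ a b : ℤ, z = ⟨a, b⟩ := by
  have hstar : IsIntegral ℤ (star z) :=
    hz.map (starRingEnd (QuadraticAlgebra ℚ (-6) 1)).toIntAlgHom
  have hinj : Function.Injective (algebraMap ℚ (QuadraticAlgebra ℚ (-6) 1)) :=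
    algebraMap_injective
  obtain ⟨t, ht⟩ : ∃ t : ℤ, (t : ℚ) = trace z := by
    refine IsIntegrallyClosed.isIntegral_iff.mp ((isIntegral_algebraMap_iff hinj).mp ?_)
    rw [algebraMap_trace_eq_add_star]
    exact hz.add hstar
  obtain ⟨n, hn⟩ : ∃ n : ℤ, (n : ℚ) = norm z := by
    refine IsIntegrallyClosed.isIntegral_iff.mp ((isIntegral_algebraMap_iff hinj).mp ?_)
    rw [algebraMap_norm_eq_mul_star]
    exact hz.mul hstar
  rw [trace_def, one_mul] at ht
  rw [norm_def] at hn
  have hsq : 23 * z.im ^ 2 = ((4 * n - t ^ 2 : ℤ) : ℚ) := by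
    push_cast
    rw [ht, hn]
    ring
  obtain ⟨m, hm⟩ : ∃ m : ℤ, (m : ℚ) = 23 * z.im := by
    refine IsIntegrallyClosed.isIntegral_iff.mp (.of_pow two_pos (x := 23 * z.im) ?_)
    rw [show (23 * z.im) ^ 2 = ((23 * (4 * n - t ^ 2) : ℤ) : ℚ) by
      rw [Int.cast_mul, ← hsq]; push_cast; ring]
    exact isIntegral_algebraMap
  have hm2 : m ^ 2 = 23 * (4 * n - t ^ 2) := by
    have : (m : ℚ) ^ 2 = ((23 * (4 * n - t ^ 2) : ℤ) : ℚ) := by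
      rw [hm, Int.cast_mul, ← hsq]; push_cast; ring
    exact_mod_cast this
  obtain ⟨b, rfl⟩ : (23 : ℤ) ∣ m := by
    have hp : Prime (23 : ℤ) := Int.prime_iff_natAbs_prime.mpr (by norm_num)
    exact hp.dvd_of_dvd_pow ⟨_, hm2⟩
  have hb : z.im = b := by
    push_cast at hm
    linarith
  have hev : Even (t - b) := by
    have : Even (t ^ 2 - b ^ 2) := ⟨2 * n - 12 * b ^ 2, by linarith⟩
    simpa [Int.even_sub, Int.even_pow] using this
  obtain ⟨a, ha⟩ := hev
  refine ⟨a, b, QuadraticAlgebra.ext ?_ hb⟩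
  have : ((t - b : ℤ) : ℚ) = ((a + a : ℤ) : ℚ) := congrArg _ ha
  push_cast at this
  simp only
  linarith

/-- The ring of integers of `ℚ(√-23)` is `ℤ[(1 + √-23) / 2]`. -/
lemma nonempty_quadraticOrder23_equiv (K : Type*) [Field K] [NumberField K] (α : K)
    (hα : α ^ 2 + 23 = 0) (hgen : Algebra.adjoin ℚ {α} = ⊤) :
    Nonempty (QuadraticOrder23 ≃+* 𝓞 K) := by
  have hfield : Fact (∀ r : ℚ, r ^ 2 ≠ -6 + 1 * r) :=
    ⟨fun r hr ↦ by nlinarith [sq_nonneg (2 * r - 1)]⟩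
  set θ : K := (1 + α) / 2 with hθ
  have hθ2 : θ * θ = (-6 : ℚ) • (1 : K) + (1 : ℚ) • θ := by
    simp only [Algebra.smul_def, hθ, map_neg, map_ofNat, map_one]
    linear_combination hα / 4
  let φ : QuadraticAlgebra ℚ (-6) 1 →ₐ[ℚ] K := QuadraticAlgebra.lift ⟨θ, hθ2⟩
  have hφ (z : QuadraticAlgebra ℚ (-6) 1) : φ z = z.re + z.im * θ := by
    refine (QuadraticAlgebra.lift_apply_apply _ _).trans ?_
    simp [Algebra.smul_def]
  have hφsurj : Function.Surjective φ := by
    rw [← AlgHom.range_eq_top, eq_top_iff, ← hgen, Algebra.adjoin_le_iff,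
      Set.singleton_subset_iff]
    refine ⟨⟨-1, 2⟩, ?_⟩
    change φ _ = _
    rw [hφ, hθ]
    push_cast
    ring
  have hθint : IsIntegral ℤ θ := by
    refine ⟨Polynomial.X ^ 2 - Polynomial.X + Polynomial.C 6, by monicity!, ?_⟩
    simp [hθ]
    linear_combination hα / 4
  let η : 𝓞 K := ⟨θ, hθint⟩
  have hηθ : algebraMap (𝓞 K) K η = θ := rfl
  have hη : η * η = (-6 : ℤ) • (1 : 𝓞 K) + (1 : ℤ) • η := by
    apply RingOfIntegers.ext
    change algebraMap (𝓞 K) K _ = algebraMap (𝓞 K) K _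
    rw [map_mul, map_add, map_zsmul, map_zsmul, map_one, hηθ, hθ2]
    simp [Algebra.smul_def]
  let ψ : QuadraticOrder23 →ₐ[ℤ] 𝓞 K := QuadraticAlgebra.lift ⟨η, hη⟩
  have hψ (z : QuadraticOrder23) : (ψ z : K) = z.re + z.im * θ := by
    change algebraMap (𝓞 K) K _ = _
    rw [show ψ z = z.re • 1 + z.im • η from QuadraticAlgebra.lift_apply_apply _ _, map_add,
      map_zsmul, map_zsmul, map_one, hηθ]
    simp
  refine ⟨RingEquiv.ofBijective ψ ⟨?_, fun x ↦ ?_⟩⟩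
  · rw [injective_iff_map_eq_zero]
    intro z hz
    have h : φ ⟨z.re, z.im⟩ = 0 := by
      rw [hφ]
      simpa [hz] using (hψ z).symm
    rw [map_eq_zero] at h
    exact QuadraticAlgebra.ext (by simpa using congrArg QuadraticAlgebra.re h)
      (by simpa using congrArg QuadraticAlgebra.im h)
  · obtain ⟨z, hz⟩ := hφsurj x
    have hzint : IsIntegral ℤ z := by
      rw [← isIntegral_algHom_iff (φ.restrictScalars ℤ) φ.toRingHom.injective]
      simpa [hz] using x.isIntegral_coe
    obtain ⟨a, b, rfl⟩ := QuadraticAlgebra.exists_int_of_isIntegral hzint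
    refine ⟨⟨a, b⟩, RingOfIntegers.ext ?_⟩
    rw [← hz, hφ]
    exact (hψ _).trans (by simp)

theorem stmt_17 (K : Type*) [Field K] [NumberField K] (α : K)
    (hα : α ^ 2 + 23 = 0) (hgen : Algebra.adjoin ℚ {α} = ⊤) :
    NumberField.classNumber K = 3 := by
  obtain ⟨e⟩ := nonempty_quadraticOrder23_equiv K α hα hgen
  have := IsDedekindDomain.of_ringEquiv e.symm
  rw [classNumber, ← Nat.card_eq_fintype_card, ← QuadraticOrder23.card_classGroup]
  exact Nat.card_congr (ClassGroup.mulEquiv e.symm).toEquiv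
end

section
/- Let K = ℚ(√−23) and let L be a splitting field of X³ − X − 1 over K. Then [L : K] = 3 and the extension L/K is unramified at all finite places: for every nonzero prime ideal 𝔭 of 𝓞_K, the ideal 𝔭·𝓞_L is squarefree in 𝓞_L, i.e., no prime ideal 𝔔 of 𝓞_L satisfies 𝔔² ∣ 𝔭·𝓞_L. -/
open NumberField Polynomial

open scoped IntermediateField

theorem monic_X_pow_three_sub_X_sub_one (F : Type*) [Field F] :
    (X ^ 3 - X - 1 : F[X]).Monic := by
  monicity!

theorem natDegree_X_pow_three_sub_X_sub_one (F : Type*) [Field F] :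
    (X ^ 3 - X - 1 : F[X]).natDegree = 3 := by
  compute_degree!

/-- A number field generated by a square root of `-23` has no element of degree three, so
`X ^ 3 - X - 1` has no root in it. -/
theorem irreducible_X_pow_three_sub_X_sub_one (K : Type*) [Field K] [NumberField K]
    (α : K) (hα : α ^ 2 + 23 = 0) (hgen : Algebra.adjoin ℚ {α} = ⊤) :
    Irreducible (X ^ 3 - X - 1 : K[X]) := by
  have hfin : Module.finrank ℚ K ≤ 2 := by
    have htop : ℚ⟮α⟯ = ⊤ := by
      rw [← IntermediateField.toSubalgebra_inj, IntermediateField.adjoin_toSubalgebra, hgen,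
        IntermediateField.top_toSubalgebra]
    rw [← IntermediateField.finrank_top', ← htop,
      IntermediateField.adjoin.finrank (Algebra.IsIntegral.isIntegral α)]
    have hdeg : (X ^ 2 + 23 : ℚ[X]).natDegree = 2 := by compute_degree!
    rw [← hdeg]
    refine natDegree_le_of_dvd (minpoly.dvd ℚ α (by simpa [map_ofNat (aeval α) 23] using hα)) fun h ↦ ?_
    simp [h] at hdeg
  refine irreducible_of_degree_le_three_of_not_isRoot
    (by simp [natDegree_X_pow_three_sub_X_sub_one]) fun x hx ↦ ?_
  have hmin := minpoly.eq_of_irreducible_of_monic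
    (X_pow_sub_X_sub_one_irreducible_rat (n := 3) (by norm_num)) (x := x)
    (by simpa [IsRoot] using hx) (monic_X_pow_three_sub_X_sub_one ℚ)
  have hle := minpoly.natDegree_le (A := ℚ) x
  rw [← hmin, natDegree_X_pow_three_sub_X_sub_one] at hle
  omega

/-- Over a field containing a square root `α` of the discriminant `-23`, a single root generates
the splitting field of `X ^ 3 - X - 1`: if `b ≠ a` are roots, then
`(2 * b + a) * (3 * a ^ 2 - 1) = ± α`. -/
theorem adjoin_root_X_pow_three_sub_X_sub_one_eq_top {K L : Type*} [Field K] [CharZero K]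
    [Field L] [Algebra K L] (α : K) (hα : α ^ 2 + 23 = 0)
    [IsSplittingField K L (X ^ 3 - X - 1)] {a : L} (ha : a ^ 3 - a - 1 = 0) : K⟮a⟯ = ⊤ := by
  have : CharZero L := charZero_of_injective_algebraMap (algebraMap K L).injective
  have hα' : algebraMap K L α ^ 2 = -23 := by
    rw [← map_pow, eq_neg_of_add_eq_zero_left hα, map_neg, map_ofNat]
  have hmem : a ∈ K⟮a⟯ := IntermediateField.mem_adjoin_simple_self K a
  rw [← IntermediateField.toSubalgebra_inj, IntermediateField.top_toSubalgebra, ← top_le_iff,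
    ← IsSplittingField.adjoin_rootSet L (X ^ 3 - X - 1 : K[X]), Algebra.adjoin_le_iff]
  intro b hb
  replace hb : b ^ 3 - b - 1 = 0 := by
    simpa using aeval_eq_zero_of_mem_rootSet hb
  by_cases hba : b = a
  · simpa [hba] using hmem
  have hq : b ^ 2 + a * b + a ^ 2 - 1 = 0 :=
    mul_left_cancel₀ (sub_ne_zero.mpr hba) (by linear_combination hb - ha)
  have hsq : ((2 * b + a) * (3 * a ^ 2 - 1)) ^ 2 = algebraMap K L α ^ 2 := by
    rw [hα']
    linear_combination 4 * (3 * a ^ 2 - 1) ^ 2 * hq + (-27 * a ^ 3 + 27 * a - 27) * ha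
  have hne : 3 * a ^ 2 - 1 ≠ 0 := by
    intro h
    rw [h, hα'] at hsq
    norm_num at hsq
  have hβ : algebraMap K L α ∈ K⟮a⟯ := algebraMap_mem _ _
  have h3 : 3 * a ^ 2 - 1 ∈ K⟮a⟯ :=
    sub_mem (mul_mem (ofNat_mem _ 3) (pow_mem hmem 2)) (one_mem _)
  have hdiv : (2 * b + a) ∈ K⟮a⟯ := by
    rcases sq_eq_sq_iff_eq_or_eq_neg.mp hsq with h | h
    · rw [eq_div_of_mul_eq hne h]
      exact div_mem hβ h3
    · rw [eq_div_of_mul_eq hne h]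
      exact div_mem (neg_mem hβ) h3
  have hb' : b = (2 * b + a - a) / 2 := by ring
  rw [hb']
  change _ ∈ K⟮a⟯
  exact div_mem (sub_mem hdiv hmem) (ofNat_mem _ 2)

/-- Three distinct roots of `X ^ 3 - X - 1` in a domain are not all congruent modulo a proper
ideal. -/
theorem eq_top_of_roots_X_pow_three_sub_X_sub_one_sub_mem {R : Type*} [CommRing R] [IsDomain R]
    (I : Ideal R) {a b c : R} (ha : a ^ 3 - a - 1 = 0) (hb : b ^ 3 - b - 1 = 0)
    (hc : c ^ 3 - c - 1 = 0) (hab : b ≠ a) (hbc : c ≠ b) (hac : a ≠ c)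
    (hbI : b - a ∈ I) (hcI : c - b ∈ I) : I = ⊤ := by
  have h₁ : b ^ 2 + a * b + a ^ 2 - 1 = 0 :=
    mul_left_cancel₀ (sub_ne_zero.mpr hab) (by linear_combination hb - ha)
  have h₂ : c ^ 2 + b * c + b ^ 2 - 1 = 0 :=
    mul_left_cancel₀ (sub_ne_zero.mpr hbc) (by linear_combination hc - hb)
  have h₃ : a + b + c = 0 :=
    mul_left_cancel₀ (sub_ne_zero.mpr hac) (by linear_combination h₁ - h₂)
  rw [Ideal.eq_top_iff_one]
  have h : (1 : R) = (b + 2 * a) * (b - a) + (-a) * (c - b + 2 * (b - a)) := by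
    linear_combination -h₁ + a * h₃
  rw [h]
  exact add_mem (I.mul_mem_left _ hbI)
    (I.mul_mem_left _ (add_mem hcI (I.mul_mem_left _ hbI)))

theorem stmt_18 (K L : Type*) [Field K] [NumberField K] [Field L] [NumberField L]
    [Algebra K L] (α : K) (hα : α ^ 2 + 23 = 0) (hgen : Algebra.adjoin ℚ {α} = ⊤)
    (hL : IsSplittingField K L (X ^ 3 - X - 1)) :
    Module.finrank K L = 3 ∧
      ∀ 𝔭 : Ideal (𝓞 K), 𝔭.IsPrime → 𝔭 ≠ ⊥ →
        ∀ 𝔔 : Ideal (𝓞 L), 𝔔.IsPrime →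
          ¬ 𝔔 ^ 2 ∣ Ideal.map (algebraMap (𝓞 K) (𝓞 L)) 𝔭 := by
  have hirr := irreducible_X_pow_three_sub_X_sub_one K α hα hgen
  have hgal : IsGalois K L := .of_separable_splitting_field hirr.separable
  obtain ⟨a, ha⟩ : ∃ a : L, a ^ 3 - a - 1 = 0 := by
    obtain ⟨a, ha⟩ := (IsSplittingField.splits L (X ^ 3 - X - 1 : K[X])).exists_eval_eq_zero (by
      rw [degree_map]
      exact hirr.degree_pos.ne')
    exact ⟨a, by simpa using ha⟩
  have htop := adjoin_root_X_pow_three_sub_X_sub_one_eq_top α hα ha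
  have hfin : Module.finrank K L = 3 := by
    rw [← IntermediateField.finrank_top', ← htop,
      IntermediateField.adjoin.finrank (Algebra.IsIntegral.isIntegral a),
      ← minpoly.eq_of_irreducible_of_monic hirr (by simpa using ha)
        (monic_X_pow_three_sub_X_sub_one K), natDegree_X_pow_three_sub_X_sub_one]
  refine ⟨hfin, fun p hp hp0 Q hQ hdvd ↦ ?_⟩
  obtain ⟨a, rfl⟩ : ∃ x : 𝓞 L, (x : L) = a :=
    ⟨⟨a, X ^ 3 - X - 1, by monicity!, by simpa using ha⟩, rfl⟩
  have hroot (τ : Gal(L/K)) : (τ • a) ^ 3 - τ • a - 1 = 0 := by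
    rw [← smul_pow', ← smul_sub]
    have ha' : a ^ 3 - a = 1 := sub_eq_zero.mp (RingOfIntegers.ext (by simpa using ha))
    rw [ha', smul_one, sub_self]
  have hfix (τ : Gal(L/K)) (hτ : τ • a = a) : τ = 1 := by
    have hadj : Algebra.adjoin K {(a : L)} = ⊤ := by
      rw [← IntermediateField.adjoin_toSubalgebra, htop, IntermediateField.top_toSubalgebra]
    have hτ' : τ a = a := congrArg (algebraMap (𝓞 L) L) hτ
    have hext : (τ : L →ₐ[K] L) = AlgHom.id K L :=
      AlgHom.ext_of_adjoin_eq_top hadj (by simpa [Set.EqOn] using hτ')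
    exact AlgEquiv.ext fun x ↦ DFunLike.congr_fun hext x
  have hcard : Nat.card (Q.inertia Gal(L/K)) = 1 := by
    rw [Subgroup.card_eq_one, Subgroup.eq_bot_iff_forall]
    intro σ hσ
    by_contra hne
    have h3 : σ ^ 3 = 1 := by
      rw [← hfin, ← IsGalois.card_aut_eq_finrank, pow_card_eq_one']
    have hmv : σ • a ≠ a := fun h ↦ hne (hfix σ h)
    refine hQ.ne_top (eq_top_of_roots_X_pow_three_sub_X_sub_one_sub_mem Q (a := a) (b := σ • a)
      (c := σ • σ • a) (by simpa using hroot 1) (hroot σ) (by simpa [mul_smul] using hroot (σ * σ))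
      hmv (fun h ↦ hmv (smul_left_cancel σ h)) (fun h ↦ hmv ?_) (hσ a) (hσ (σ • a)))
    conv_lhs => rw [h]
    rw [← mul_smul, ← mul_smul, ← pow_two, ← pow_succ, h3, one_smul]
  have hle := Ideal.le_of_dvd hdvd
  have hle' : p.map (algebraMap (𝓞 K) (𝓞 L)) ≤ Q := hle.trans (Ideal.pow_le_self two_ne_zero)
  have : Q.LiesOver p := ⟨(hp.isMaximal hp0).eq_of_le (hQ.comap _).ne_top
    (Ideal.map_le_iff_le_comap.mp hle')⟩
  rw [Ideal.card_inertia_eq_ramificationIdxIn p,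
    Ideal.ramificationIdxIn_eq_ramificationIdx p Q Gal(L/K),
    ← Ideal.ramificationIdx'_eq_ramificationIdx p Q hp0] at hcard
  exact (Ideal.ramificationIdx'_ne_one_iff hle').mpr hle hcard
end

section
/- (Kronecker's theorem on n+1 equations.) Let k be an algebraically closed field of characteristic zero and let P be a prime ideal of the polynomial ring k[x_1, …, x_n]. Then there exist n+1 polynomials f_1, …, f_{n+1} ∈ P such that the set of common zeros of f_1, …, f_{n+1} in kⁿ is exactly the zero locus of P, i.e., the set of points of kⁿ at which every element of P vanishes. -/
/-- Successive prime avoidance: in a Noetherian ring, any ideal `I` contains `m` elements such that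
every minimal prime over them not containing `I` has height at least `m`. -/
theorem Ideal.exists_fin_forall_le_height_of_mem_minimalPrimes {R : Type*} [CommRing R]
    [IsNoetherianRing R] (I : Ideal R) (m : ℕ) :
    ∃ f : Fin m → R, (∀ i, f i ∈ I) ∧
      ∀ q ∈ (Ideal.span (Set.range f)).minimalPrimes, ¬ I ≤ q → (m : ℕ∞) ≤ q.height := by
  induction m with
  | zero => exact ⟨Fin.elim0, fun i => i.elim0, fun q _ _ => by simp⟩
  | succ m ih =>
    obtain ⟨f, hfI, hf⟩ := ih
    set S := {q ∈ (Ideal.span (Set.range f)).minimalPrimes | ¬ I ≤ q}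
    have hS : S.Finite :=
      (Ideal.finite_minimalPrimes_of_isNoetherianRing R _).subset (Set.sep_subset _ _)
    have hnot : ¬ ((I : Set R) ⊆ ⋃ q ∈ S, (q : Set R)) := by
      rw [Ideal.subset_union_prime_finite hS (f := fun q : Ideal R => q) ⊥ ⊥
        (fun q hq _ _ => hq.1.1.1)]
      rintro ⟨q, hq, hIq⟩
      exact hq.2 hIq
    obtain ⟨g, hgI, hg⟩ := Set.not_subset.mp hnot
    refine ⟨Fin.snoc f g, fun i => ?_, fun q' hq' hIq' => ?_⟩
    · induction i using Fin.lastCases with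
      | last => simpa using hgI
      | cast i => simpa using hfI i
    · have hmem (i : Fin (m + 1)) : (Fin.snoc f g : Fin (m + 1) → R) i ∈ q' :=
        hq'.1.2 (Ideal.subset_span ⟨i, rfl⟩)
      have hle : Ideal.span (Set.range f) ≤ q' := by
        rw [Ideal.span_le]
        rintro _ ⟨i, rfl⟩
        simpa using hmem i.castSucc
      have := hq'.1.1
      obtain ⟨q, hq, hqq'⟩ := Ideal.exists_minimalPrimes_le hle
      have hIq : ¬ I ≤ q := fun h => hIq' (h.trans hqq')
      have hgq : g ∉ q := fun h =>
        hg (Set.mem_biUnion (show q ∈ S from ⟨hq, hIq⟩) h)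
      have hlt : q < q' := lt_of_le_of_ne hqq' fun h =>
        hgq (h ▸ by simpa using hmem (Fin.last m))
      have := hq.1.1
      push_cast
      exact (add_le_add_left (hf q hq hIq) 1).trans
        (Ideal.height_add_one_le_of_lt_of_isPrime hlt)

/-- **Kronecker's theorem**: in a Noetherian ring of Krull dimension at most `n`, every ideal is
contained in the radical of an ideal generated by `n + 1` of its elements. -/
theorem Ideal.exists_fin_le_radical_span {R : Type*} [CommRing R] [IsNoetherianRing R] {n : ℕ}
    (hn : ringKrullDim R ≤ n) (I : Ideal R) :
    ∃ f : Fin (n + 1) → R, (∀ i, f i ∈ I) ∧ I ≤ (Ideal.span (Set.range f)).radical := by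
  obtain ⟨f, hfI, hf⟩ := I.exists_fin_forall_le_height_of_mem_minimalPrimes (n + 1)
  refine ⟨f, hfI, ?_⟩
  rw [← Ideal.sInf_minimalPrimes]
  refine le_sInf fun q hq => ?_
  by_contra hIq
  have h1 := hf q hq hIq
  have h2 : (q.height : WithBot ℕ∞) ≤ n :=
    (Ideal.height_le_ringKrullDim_of_ne_top hq.1.1.ne_top).trans hn
  have h3 : ((n + 1 : ℕ) : ℕ∞) ≤ (n : ℕ) := h1.trans (by exact_mod_cast h2)
  have h4 : n + 1 ≤ n := by exact_mod_cast h3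
  omega

theorem stmt_19 (k : Type*) [Field k] [IsAlgClosed k] [CharZero k] (n : ℕ)
    (P : Ideal (MvPolynomial (Fin n) k)) (hP : P.IsPrime) :
    ∃ f : Fin (n + 1) → MvPolynomial (Fin n) k, (∀ i, f i ∈ P) ∧
      {a : Fin n → k | ∀ i, MvPolynomial.eval a (f i) = 0} =
        {a : Fin n → k | ∀ g ∈ P, MvPolynomial.eval a g = 0} := by
  have hn : ringKrullDim (MvPolynomial (Fin n) k) ≤ n := by
    simp [MvPolynomial.ringKrullDim_of_isNoetherianRing]
  obtain ⟨f, hfP, hf⟩ := P.exists_fin_le_radical_span hn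
  refine ⟨f, hfP, Set.Subset.antisymm (fun a ha g hg => ?_) fun a ha i => ha _ (hfP i)⟩
  have hle : Ideal.span (Set.range f) ≤ RingHom.ker (MvPolynomial.eval a) := by
    rw [Ideal.span_le]
    rintro _ ⟨i, rfl⟩
    exact ha i
  obtain ⟨N, hN⟩ := hf hg
  have h0 : MvPolynomial.eval a (g ^ N) = 0 := hle hN
  rw [map_pow] at h0
  exact eq_zero_of_pow_eq_zero h0
end
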